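/- arXiv:2201.12582 — 3 statements merged into one kernel-verified Lean document; each statement's English description precedes it below -/
import Mathlib

section
/- Let h ≥ 1 and let m_1, ..., m_{h-1} be integers with m_i ≥ 3 for 1 ≤ i ≤ h-1. Then rn(T^2_{2, m_1, ..., m_{h-1}}) = Σ_{i=1}^{h-1} (4(h-i) - 2) · Π_{j=1}^{i} (m_j - 1) + 2·Π_{i=1}^{h-1} (m_i - 1) + 6h - 3. -/
open SimpleGraph Finset

open scoped Classical

namespace RadioPaper

variable {V : Type*} [Fintype V] [DecidableEq V]

/-- The diameter of a graph: the maximum distance between two vertices. -/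
noncomputable def gdiam (G : SimpleGraph V) : ℕ :=
  Finset.univ.sup fun pr : V × V => G.dist pr.1 pr.2

/-- A radio labelling of `G`: `|f u - f v| ≥ diam G + 1 - d(u,v)` for distinct `u, v`. -/
def IsRadioLabelling (G : SimpleGraph V) (f : V → ℕ) : Prop :=
  ∀ u v : V, u ≠ v → (gdiam G : ℤ) + 1 - (G.dist u v : ℤ) ≤ |(f u : ℤ) - (f v : ℤ)|

/-- The span of a labelling: the maximum difference between two labels. -/
noncomputable def span (f : V → ℕ) : ℕ :=
  Finset.univ.sup fun pr : V × V => f pr.1 - f pr.2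

/-- The radio number of `G`: the minimum span of a radio labelling. -/
noncomputable def radioNumber (G : SimpleGraph V) : ℕ :=
  sInf {s | ∃ f : V → ℕ, IsRadioLabelling G f ∧ span f = s}

/-- The weight of `G` from `v`. -/
noncomputable def weight (G : SimpleGraph V) (v : V) : ℕ := ∑ u : V, G.dist u v

/-- The set of weight centers: vertices of minimum weight. -/
noncomputable def wcenters (G : SimpleGraph V) : Finset V :=
  Finset.univ.filter fun v => ∀ u : V, weight G v ≤ weight G u

/-- `ε(T) = 2 - |W(T)|`. -/
noncomputable def eps (G : SimpleGraph V) : ℕ := 2 - (wcenters G).card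

/-- The level of a vertex: its minimum distance to a weight center. -/
noncomputable def level (G : SimpleGraph V) (u : V) : ℕ :=
  sInf {n | ∃ x ∈ wcenters G, G.dist u x = n}

/-- The total level of `G`. -/
noncomputable def totalLevel (G : SimpleGraph V) : ℕ := ∑ u : V, level G u

/-- `T` is a two-branch tree: removing the weight centers leaves exactly two components. -/
def TwoBranch (G : SimpleGraph V) : Prop :=
  Nat.card (SimpleGraph.induce {v : V | v ∉ wcenters G} G).ConnectedComponent = 2

/-- The set of remote vertices `S(T)`. -/
noncomputable def remote (G : SimpleGraph V) : Finset V :=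
  if (wcenters G).card = 1 then Finset.univ.filter fun u => (gdiam G + 1) / 2 ≤ level G u
  else Finset.univ.filter fun u => gdiam G / 2 ≤ level G u

/-- `ξ(T)`. -/
noncomputable def xi (G : SimpleGraph V) : ℕ :=
  if (wcenters G).card = 1 then (remote G).card / 2 else (remote G).card - 2

/-- `u` and `v` lie in different branches: the path between them traverses exactly one
weight center. -/
def DiffBranches (G : SimpleGraph V) (u v : V) : Prop :=
  ∀ p : G.Path u v, (p.1.support.filter fun x => decide (x ∈ wcenters G)).length = 1

/-- `u` and `v` lie in opposite branches: the path between them traverses two weight centers. -/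
def OppBranches (G : SimpleGraph V) (u v : V) : Prop :=
  ∀ p : G.Path u v, (p.1.support.filter fun x => decide (x ∈ wcenters G)).length = 2

/-- `u` and `v` lie in the same branch of `T - W(T)`. -/
def SameBranch (G : SimpleGraph V) (u v : V) : Prop :=
  ∃ (hu : u ∉ wcenters G) (hv : v ∉ wcenters G),
    (SimpleGraph.induce {x : V | x ∉ wcenters G} G).Reachable ⟨u, hu⟩ ⟨v, hv⟩

/-- `x` is an ancestor of `v`: `x` lies on the path joining a weight center and `v`. -/
def IsAncestor (G : SimpleGraph V) (x v : V) : Prop :=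
  ∃ w ∈ wcenters G, ∀ p : G.Path w v, x ∈ p.1.support

/-- `φ(u,v)`: the maximum level of a common ancestor of `u` and `v`. -/
noncomputable def phi (G : SimpleGraph V) (u v : V) : ℕ :=
  sSup {n | ∃ x : V, IsAncestor G x u ∧ IsAncestor G x v ∧ level G x = n}

/-- `δ(u,v)`. -/
noncomputable def deltaWC (G : SimpleGraph V) (u v : V) : ℕ :=
  if (wcenters G).card = 2 ∧ ∀ p : G.Path u v, ∀ w ∈ wcenters G, w ∈ p.1.support then 1 else 0

/-- `u` enumerates the vertices of `G` in strictly increasing order of labels under `f`. -/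
def IsInducedOrder (G : SimpleGraph V) (f : V → ℕ) (u : ℕ → V) : Prop :=
  (∀ v : V, ∃! i : ℕ, i < Fintype.card V ∧ u i = v) ∧
  ∀ i j : ℕ, i < j → j < Fintype.card V → f (u i) < f (u j)

/-- `J_f(u_t, u_{t+1})`. -/
noncomputable def Jstep (G : SimpleGraph V) (f : V → ℕ) (u : ℕ → V) (t : ℕ) : ℤ :=
  ((f (u (t+1)) : ℤ) - (f (u t) : ℤ)) + (G.dist (u t) (u (t+1)) : ℤ) - ((gdiam G : ℤ) + 1)

/-- `J_f(u_i, …, u_j)`. -/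
noncomputable def Jseg (G : SimpleGraph V) (f : V → ℕ) (u : ℕ → V) (i j : ℕ) : ℤ :=
  ∑ t ∈ Finset.Ico i j, Jstep G f u t

/-- `σ(f)`. -/
noncomputable def sigmaF (G : SimpleGraph V) (f : V → ℕ) (u : ℕ → V) : ℤ :=
  ∑ t ∈ Finset.range (Fintype.card V - 1),
    (Jstep G f u t + 2 * (phi G (u t) (u (t+1)) : ℤ) - (deltaWC G (u t) (u (t+1)) : ℤ))

/-- Consecutive vertices in the order are in different branches when `|W(T)| = 1`
and in opposite branches when `|W(T)| = 2`. -/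
def BranchStep (G : SimpleGraph V) (u v : V) : Prop :=
  ((wcenters G).card = 1 → DiffBranches G u v) ∧
  ((wcenters G).card = 2 → OppBranches G u v)

/-- `f ∈ F`: every pair of consecutive vertices of the induced order is in different
branches when `|W(T)| = 1` and in opposite branches when `|W(T)| = 2`. -/
def MemF (G : SimpleGraph V) (f : V → ℕ) (u : ℕ → V) : Prop :=
  ∀ i : ℕ, i + 1 < Fintype.card V → BranchStep G (u i) (u (i+1))

/-- `u_i, u_{i+1}` is a bad pair. -/
def BadPair (G : SimpleGraph V) (u : ℕ → V) (i : ℕ) : Prop :=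
  i + 1 < Fintype.card V ∧ u i ∉ wcenters G ∧ u (i+1) ∉ wcenters G ∧
    SameBranch G (u i) (u (i+1))

/-- `X_f`: the set of vertices in at least one bad pair. -/
noncomputable def Xf (G : SimpleGraph V) (u : ℕ → V) : Finset V :=
  Finset.univ.filter fun v => ∃ i : ℕ, BadPair G u i ∧ (v = u i ∨ v = u (i+1))

/-- `[i, j]` is a maximal run of positions (within `[0, p-1]`) satisfying `P`. -/
def IsMaxRun (p : ℕ) (P : ℕ → Prop) (i j : ℕ) : Prop :=
  i ≤ j ∧ j < p ∧ (∀ t, i ≤ t → t ≤ j → P t) ∧ (i = 0 ∨ ¬P (i - 1)) ∧ (j = p - 1 ∨ ¬P (j + 1))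

/-- The number of maximal runs of `P` having odd length. -/
noncomputable def oddRunCount (p : ℕ) (P : ℕ → Prop) : ℕ :=
  ((Finset.range p ×ˢ Finset.range p).filter fun ij : ℕ × ℕ =>
    IsMaxRun p P ij.1 ij.2 ∧ Odd (ij.2 - ij.1 + 1)).card

/-- The linear order `u` is feasible. -/
def Feasible (G : SimpleGraph V) (u : ℕ → V) : Prop :=
  (Even (remote G).card →
    oddRunCount (Fintype.card V) (fun t => u t ∈ remote G) = 0) ∧
  (Odd (remote G).card →
    oddRunCount (Fintype.card V) (fun t => u t ∈ remote G) ≤ 1)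

/-- Position `t` is immediately before or after a weight center in the order `u`. -/
def NearWC (G : SimpleGraph V) (u : ℕ → V) (t : ℕ) : Prop :=
  (t + 1 < Fintype.card V ∧ u (t+1) ∈ wcenters G) ∨ (1 ≤ t ∧ u (t-1) ∈ wcenters G)

/-- Position `t` holds a remote vertex not immediately before or after a weight center. -/
def RemainingRemote (G : SimpleGraph V) (u : ℕ → V) (t : ℕ) : Prop :=
  t < Fintype.card V ∧ u t ∈ remote G ∧ ¬NearWC G u t

/-- The linear order `u` is admissible. -/
def Admissible (G : SimpleGraph V) (u : ℕ → V) : Prop :=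
  (∀ t : ℕ, t < Fintype.card V → u t ∈ wcenters G →
    (1 ≤ t → u (t-1) ∈ remote G) ∧ (t + 1 < Fintype.card V → u (t+1) ∈ remote G)) ∧
  (Even ((Finset.range (Fintype.card V)).filter fun t => RemainingRemote G u t).card →
    oddRunCount (Fintype.card V) (RemainingRemote G u) = 0) ∧
  (Odd ((Finset.range (Fintype.card V)).filter fun t => RemainingRemote G u t).card →
    oddRunCount (Fintype.card V) (RemainingRemote G u) ≤ 1)

/-- Condition (a) of Theorem `thm:lower` on the linear order `u`. -/
def OrderCondA (G : SimpleGraph V) (u : ℕ → V) : Prop :=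
  ((wcenters G).card = 1 →
    (Odd (remote G).card →
      level G (u 0) + level G (u (Fintype.card V - 1)) = 1 ∧ Admissible G u) ∧
    (Even (remote G).card →
      (level G (u 0) + level G (u (Fintype.card V - 1)) = 1 ∧
        (Feasible G u ∨ Admissible G u)) ∨
      (level G (u 0) + level G (u (Fintype.card V - 1)) = 2 ∧ Admissible G u))) ∧
  ((wcenters G).card = 2 →
    Admissible G u ∧
    ((remote G).card = 1 ∨ (remote G).card = 2 →
      level G (u 0) + level G (u (Fintype.card V - 1)) = 0) ∧
    (3 ≤ (remote G).card → Odd (remote G).card →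
      level G (u 0) + level G (u (Fintype.card V - 1)) = 1) ∧
    (4 ≤ (remote G).card → Even (remote G).card →
      level G (u 0) + level G (u (Fintype.card V - 1)) = 0 ∨
      level G (u 0) + level G (u (Fintype.card V - 1)) = 2))

/-- Condition (b) of Theorem `thm:lower`: the distance inequality. -/
def OrderCondB (G : SimpleGraph V) (u : ℕ → V) (a : ℕ → ℕ) : Prop :=
  ∀ i j : ℕ, i < j → j ≤ Fintype.card V - 1 →
    (∑ t ∈ Finset.Ico i j,
      ((level G (u t) : ℤ) + (level G (u (t+1)) : ℤ) - (a t : ℤ)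
        - ((gdiam G : ℤ) + (eps G : ℤ))))
      + ((gdiam G : ℤ) + 1) ≤ (G.dist (u i) (u j) : ℤ)

/-- The sequence `a_0, …, a_{p-2}` determined by the order `u` via `(eq:a0)`–`(eq:seq)`. -/
def SeqA (G : SimpleGraph V) (u : ℕ → V) (a : ℕ → ℕ) : Prop :=
  a 0 = 0 ∧
  ∀ t : ℕ, 1 ≤ t → t ≤ Fintype.card V - 2 →
    a (t-1) + a t =
      if u t ∈ remote G ∧ u (t-1) ∉ wcenters G ∧ u (t+1) ∉ wcenters G
      then (wcenters G).card else 0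

/-- The spine index set of the caterpillar `C(n,k)`. -/
def spineSet (n : ℕ) : Finset ℕ :=
  if n % 2 = 1 then {1, (n-1)/2, (n+3)/2, n} else {1, (n-2)/2, (n+4)/2, n}

/-- `G` is (isomorphic to) the caterpillar `C(n,k)`. -/
def IsCaterpillarC (G : SimpleGraph V) (n k : ℕ) : Prop :=
  G.IsTree ∧
  ∃ v : ℕ → V,
    (∀ i j : ℕ, 1 ≤ i → i ≤ n → 1 ≤ j → j ≤ n → v i = v j → i = j) ∧
    (∀ i : ℕ, 1 ≤ i → i < n → G.Adj (v i) (v (i+1))) ∧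
    (∀ x : V, (∃ i : ℕ, 1 ≤ i ∧ i ≤ n ∧ v i = x) ∨ (G.neighborSet x).ncard = 1) ∧
    (∀ i : ℕ, 1 ≤ i → i ≤ n →
      {x ∈ G.neighborSet (v i) | (G.neighborSet x).ncard = 1}.ncard =
        if i ∈ spineSet n then k else 0)

/-- `G` is (isomorphic to) the level-wise regular tree `T^z_{m_0, …, m_{h-1}}`:
a tree with a center `C` of `z` vertices (adjacent when `z = 2`), height `h`,
in which every vertex at distance `i < h` from `C` has degree `m i` and every
vertex at distance `h` from `C` is a leaf. -/
def IsLevelwiseRegular (G : SimpleGraph V) (z h : ℕ) (m : ℕ → ℕ) : Prop :=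
  G.IsTree ∧
  ∃ (C : Finset V) (dC : V → ℕ),
    C.card = z ∧
    (∀ c ∈ C, ∀ c' ∈ C, c ≠ c' → G.Adj c c') ∧
    (∀ x : V, IsLeast {n | ∃ c ∈ C, G.dist x c = n} (dC x)) ∧
    (∀ x : V, dC x ≤ h) ∧
    (∀ x : V, dC x = h → (G.neighborSet x).ncard = 1) ∧
    (∀ x : V, dC x < h → (G.neighborSet x).ncard = m (dC x))

/-- In a tree, the neighbour of `x` that is closer to `r` is unique. -/
theorem eq_of_adj_of_dist_eq_add_one {W : Type*} {G : SimpleGraph W} (hG : G.IsTree) {r x y y' : W}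
    (hy : G.Adj x y) (hy' : G.Adj x y') (hd : G.dist r x = G.dist r y + 1)
    (hd' : G.dist r x = G.dist r y' + 1) : y = y' := by
  obtain ⟨q, hq, -⟩ := hG.connected.exists_path_of_dist r x
  have key : ∀ z, G.Adj x z → G.dist r x = G.dist r z + 1 → z = q.penultimate := by
    intro z hz hdz
    obtain ⟨p, hp, hpl⟩ := hG.connected.exists_path_of_dist r z
    refine hG.isAcyclic.eq_penultimate_of_adj_end hq hz ?_
    refine hG.isAcyclic.mem_support_of_ne_mem_support_of_adj_of_isPath hq hp hz ?_
    intro hx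
    have h1 := G.dist_le (p.takeUntil x hx)
    have h2 := p.length_takeUntil_le_length hx
    omega
  rw [key y hy hd, key y' hy' hd']

/-- In a connected graph, a vertex different from `a` has a neighbour closer to `a`. -/
theorem exists_adj_dist_eq_add_one {W : Type*} {G : SimpleGraph W} (hG : G.Connected) {a x : W}
    (hx : x ≠ a) : ∃ z, G.Adj x z ∧ G.dist a x = G.dist a z + 1 := by
  obtain ⟨p, hp⟩ := hG.exists_walk_length_eq_dist x a
  cases p with
  | nil => exact absurd rfl hx
  | @cons _ z _ hxz p =>
    refine ⟨z, hxz, ?_⟩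
    have e1 := G.dist_le p
    have e2 : G.dist a x ≤ G.dist a z + G.dist z x := hG.dist_triangle
    have e3 : G.dist z x = 1 := dist_eq_one_iff_adj.2 hxz.symm
    rw [dist_comm] at e1
    rw [dist_comm (u := x)] at hp
    simp only [Walk.length_cons] at hp
    omega

/-- In a tree with two adjacent vertices `a`, `b`, consider a vertex `x` off the edge `ab` and
closer to `a`.  Its neighbours are all closer to `a`. -/
theorem dist_of_adj_of_dist_lt {W : Type*} {G : SimpleGraph W} (hG : G.IsTree) {a b x y : W}
    (hab : G.Adj a b) (hx : x ≠ a) (hlt : G.dist b x = G.dist a x + 1) (hxy : G.Adj x y) :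
    G.dist b y = G.dist a y + 1 := by
  have h0 : G.dist a x ≠ 0 := by
    rw [Ne, hG.connected.dist_eq_zero_iff]; exact fun e => hx e.symm
  have h1 := hG.dist_eq_dist_add_one_of_adj a hxy
  have h2 := hG.dist_eq_dist_add_one_of_adj b hxy
  have h3 := hG.dist_eq_dist_add_one_of_adj y hab
  rw [dist_comm (u := y), dist_comm (u := y)] at h3
  by_contra hne
  have h4 : G.dist a y = G.dist a x + 1 := by omega
  have h5 : G.dist b y = G.dist a x := by omega
  obtain ⟨z, hz, hz'⟩ := exists_adj_dist_eq_add_one hG.connected hx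
  have h6 := hG.dist_eq_dist_add_one_of_adj b hz
  have h7 := hG.dist_eq_dist_add_one_of_adj z hab
  rw [dist_comm (u := z), dist_comm (u := z)] at h7
  have h8 : y = z := eq_of_adj_of_dist_eq_add_one hG (r := b) hxy hz (by omega) (by omega)
  subst h8
  omega

/-- A graph spanned by two adjacent roots `c false`, `c true` of level `0`, in which every other
vertex `x` has a parent one level below, on the same side, and every vertex at level `i < h` has
`m i - 1` children. -/
structure BiRooted (G : SimpleGraph V) (h : ℕ) (m : ℕ → ℕ) where
  lev : V → ℕ
  side : V → Bool
  par : V → V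
  c : Bool → V
  lev_c : ∀ s, lev (c s) = 0
  side_c : ∀ s, side (c s) = s
  eq_c : ∀ x, lev x = 0 → x = c (side x)
  adj_c : G.Adj (c false) (c true)
  lev_par : ∀ x, lev x ≠ 0 → lev (par x) + 1 = lev x
  side_par : ∀ x, lev x ≠ 0 → side (par x) = side x
  adj_par : ∀ x, lev x ≠ 0 → G.Adj x (par x)
  adj_cases : ∀ x y, G.Adj x y → (lev x ≠ 0 ∧ y = par x) ∨ (lev y ≠ 0 ∧ x = par y) ∨
    (lev x = 0 ∧ lev y = 0 ∧ side x ≠ side y)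
  lev_le : ∀ x, lev x ≤ h
  card_children : ∀ x, lev x < h →
    (Finset.univ.filter fun y => lev y ≠ 0 ∧ par y = x).card = m (lev x) - 1

theorem nonempty_biRooted {G : SimpleGraph V} {h : ℕ} {m : ℕ → ℕ}
    (hG : IsLevelwiseRegular G 2 h m) : Nonempty (BiRooted G h m) := by
  obtain ⟨hT, C, dC, hC, hCadj, hdC, hle, -, hdeg⟩ := hG
  obtain ⟨a, b, hab, rfl⟩ := Finset.card_eq_two.1 hC
  have hadj : G.Adj a b := hCadj a (by simp) b (by simp) hab
  have hmin : ∀ x, dC x = min (G.dist a x) (G.dist b x) := by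
    intro x
    obtain ⟨⟨c, hc, hcx⟩, hlb⟩ := hdC x
    have h1 := hlb ⟨a, by simp, rfl⟩
    have h2 := hlb ⟨b, by simp, rfl⟩
    rw [dist_comm (u := x)] at h1 h2 hcx
    simp only [Finset.mem_insert, Finset.mem_singleton] at hc
    rcases hc with rfl | rfl <;> omega
  let c : Bool → V := fun s => if s then b else a
  have hcadj : ∀ s, G.Adj (c s) (c !s) := by
    intro s; cases s
    · exact hadj
    · exact hadj.symm
  let side : V → Bool := fun x => decide (G.dist b x < G.dist a x)
  have hcl : ∀ x, G.dist (c (side x)) x = dC x ∧ G.dist (c (!side x)) x = dC x + 1 := by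
    intro x
    have h3 := hT.dist_eq_dist_add_one_of_adj x hadj
    rw [dist_comm (u := x), dist_comm (u := x)] at h3
    have h4 := hmin x
    by_cases hs : G.dist b x < G.dist a x
    · have : side x = true := by simp [side, hs]
      simp only [this, c]; simp; omega
    · have : side x = false := by simp [side, hs]
      simp only [this, c]; simp; omega
  have hside : ∀ x s, G.dist (c (!s)) x = G.dist (c s) x + 1 → side x = s := by
    intro x s hs
    have := hcl x
    by_contra hne
    have e : s = !side x := by cases s <;> cases hq : side x <;> simp_all
    subst e
    simp only [Bool.not_not] at hs
    omega
  have hclose : ∀ x, dC x ≠ 0 → ∃ z, G.Adj x z ∧ dC z + 1 = dC x ∧ side z = side x := by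
    intro x hx
    have hne : x ≠ c (side x) := by
      intro e
      have := (hcl x).1
      rw [← e] at this
      simp at this; omega
    obtain ⟨z, hz, hz'⟩ := exists_adj_dist_eq_add_one hT.connected hne
    have h1 := hcl x
    have h2 := dist_of_adj_of_dist_lt hT (hcadj (side x)) hne (by omega) hz
    have h3 := hside z _ h2
    refine ⟨z, hz, ?_, h3⟩
    have h4 := hcl z
    rw [h3] at h4
    omega
  choose! par hpadj hplev hpside using hclose
  have hzero : ∀ x, dC x = 0 → x = c (side x) := by
    intro x hx
    have := (hcl x).1
    rw [hx, hT.connected.dist_eq_zero_iff] at this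
    exact this.symm
  have hdiff : ∀ x y, G.Adj x y → side x = side y → dC x = dC y + 1 ∨ dC y = dC x + 1 := by
    intro x y hxy hs
    have := hT.dist_eq_dist_add_one_of_adj (c (side x)) hxy
    rw [(hcl x).1, hs, (hcl y).1] at this
    exact this
  have hpar : ∀ x y, G.Adj x y → side x = side y → dC x = dC y + 1 → y = par x := by
    intro x y hxy hs hd
    have hx : dC x ≠ 0 := by omega
    refine eq_of_adj_of_dist_eq_add_one hT (r := c (side x)) hxy (hpadj x hx) ?_ ?_
    · rw [(hcl x).1, hs, (hcl y).1, hd]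
    · rw [(hcl x).1, ← hpside x hx, (hcl _).1, hplev x hx]
  have hsame : ∀ x y, G.Adj x y → dC x ≠ 0 → side y = side x := by
    intro x y hxy hx
    have hne : x ≠ c (side x) := by
      intro e
      have := (hcl x).1
      rw [← e] at this
      simp at this; omega
    have h1 := hcl x
    exact hside y _ (dist_of_adj_of_dist_lt hT (hcadj (side x)) hne (by omega) hxy)
  have hlevc : ∀ s, dC (c s) = 0 := by
    intro s
    rw [hmin]
    cases s <;> simp [c]
  have hsidec : ∀ s, side (c s) = s := by
    intro s
    refine hside _ _ ?_
    rw [dist_self, dist_eq_one_iff_adj.2 (hcadj s).symm]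
  have hcases : ∀ x y, G.Adj x y → (dC x ≠ 0 ∧ y = par x) ∨ (dC y ≠ 0 ∧ x = par y) ∨
      (dC x = 0 ∧ dC y = 0 ∧ side x ≠ side y) := by
    intro x y hxy
    by_cases hs : side x = side y
    · rcases hdiff x y hxy hs with hd | hd
      · exact Or.inl ⟨by omega, hpar x y hxy hs hd⟩
      · exact Or.inr (Or.inl ⟨by omega, hpar y x hxy.symm hs.symm hd⟩)
    · refine Or.inr (Or.inr ⟨?_, ?_, hs⟩)
      · by_contra hx
        exact hs (hsame x y hxy hx).symm
      · by_contra hy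
        exact hs (hsame y x hxy.symm hy)
  refine ⟨⟨dC, side, par, c, hlevc, hsidec, hzero, hadj, hplev, hpside, hpadj, hcases, hle, ?_⟩⟩
  intro x hx
  have hns : ∃ w, G.neighborSet x = insert w
      (↑(Finset.univ.filter fun y => dC y ≠ 0 ∧ par y = x) : Set V) ∧
      w ∉ (Finset.univ.filter fun y => dC y ≠ 0 ∧ par y = x) := by
    by_cases h0 : dC x = 0
    · refine ⟨c (!side x), ?_, by simp [hlevc]⟩
      ext y
      simp only [mem_neighborSet, Set.mem_insert_iff, Finset.coe_filter, Finset.mem_univ, true_and,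
        Set.mem_ofPred_eq]
      constructor
      · intro hxy
        rcases hcases x y hxy with ⟨h1, -⟩ | ⟨h1, h2⟩ | ⟨-, h1, h2⟩
        · exact absurd h0 h1
        · exact Or.inr ⟨h1, h2.symm⟩
        · left
          rw [hzero y h1]
          rw [Bool.eq_not_of_ne h2.symm]
      · rintro (rfl | ⟨h1, rfl⟩)
        · have := hcadj (side x)
          rwa [← hzero x h0] at this
        · exact (hpadj y h1).symm
    · refine ⟨par x, ?_, ?_⟩
      · ext y
        simp only [mem_neighborSet, Set.mem_insert_iff, Finset.coe_filter, Finset.mem_univ,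
          true_and, Set.mem_ofPred_eq]
        constructor
        · intro hxy
          rcases hcases x y hxy with ⟨-, h1⟩ | ⟨h1, h2⟩ | ⟨h1, -⟩
          · exact Or.inl h1
          · exact Or.inr ⟨h1, h2.symm⟩
          · exact absurd h1 h0
        · rintro (rfl | ⟨h1, rfl⟩)
          · exact hpadj x h0
          · exact (hpadj y h1).symm
      · simp only [Finset.mem_filter, Finset.mem_univ, true_and, not_and]
        intro h1 h2
        have h3 := hplev _ h1
        have h4 := hplev _ h0
        rw [h2] at h3
        omega
  obtain ⟨w, hw, hw'⟩ := hns
  have h1 := hdeg x hx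
  rw [hw, Set.ncard_insert_of_notMem (by exact_mod_cast hw'), Set.ncard_coe_finset] at h1
  omega

/-- The number of vertices at level `i` on each side. -/
def levelCount (m : ℕ → ℕ) (i : ℕ) : ℕ := ∏ j ∈ Finset.range i, (m j - 1)

theorem levelCount_succ (m : ℕ → ℕ) (i : ℕ) :
    levelCount m (i + 1) = levelCount m i * (m i - 1) := Finset.prod_range_succ _ _

theorem le_levelCount {h : ℕ} {m : ℕ → ℕ} (hm0 : m 0 = 2)
    (hm : ∀ i : ℕ, 1 ≤ i → i ≤ h - 1 → 3 ≤ m i) {i : ℕ} (hi : i ≤ h) : i ≤ levelCount m i := by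
  induction i with
  | zero => exact Nat.zero_le _
  | succ i ih =>
    rw [levelCount_succ]
    rcases Nat.eq_zero_or_pos i with rfl | hi0
    · simp [levelCount, hm0]
    · have h1 := ih (by omega)
      have h2 := hm i hi0 (by omega)
      calc i + 1 ≤ i * 2 := by omega
        _ ≤ _ := Nat.mul_le_mul h1 (by omega)

namespace BiRooted

variable {G : SimpleGraph V} {h : ℕ} {m : ℕ → ℕ} (D : BiRooted G h m)

theorem par_eq_c_of_lev_eq_one {x : V} (hx : D.lev x = 1) : D.par x = D.c (D.side x) := by
  have h1 := D.lev_par x (by omega)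
  rw [D.eq_c (D.par x) (by omega), D.side_par x (by omega)]

theorem lev_iterate_par (x : V) (k : ℕ) (hk : k ≤ D.lev x) :
    D.lev (D.par^[k] x) + k = D.lev x := by
  induction k with
  | zero => rfl
  | succ k ih =>
    have h1 := ih (by omega)
    rw [Function.iterate_succ_apply']
    have h2 := D.lev_par (D.par^[k] x) (by omega)
    omega

/-- The ancestors of `x` of positive level, including `x` itself. -/
def anc (x : V) : Finset V := (Finset.range (D.lev x)).image fun k => D.par^[k] x

theorem anc_of_lev_eq_zero {x : V} (hx : D.lev x = 0) : D.anc x = ∅ := by simp [anc, hx]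

theorem anc_eq_insert {x : V} (hx : D.lev x ≠ 0) : D.anc x = insert x (D.anc (D.par x)) := by
  rw [anc, anc, ← D.lev_par x hx, Finset.range_add_one', Finset.image_insert, Finset.map_eq_image,
    Finset.image_image]
  rfl

theorem card_anc (x : V) : (D.anc x).card = D.lev x := by
  rw [anc, Finset.card_image_of_injOn, Finset.card_range]
  intro k hk l hl hkl
  have hk' := Finset.mem_range.1 hk
  have hl' := Finset.mem_range.1 hl
  have h1 := D.lev_iterate_par x k hk'.le
  have h2 := D.lev_iterate_par x l hl'.le
  simp only at hkl
  rw [hkl] at h1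
  omega

/-- The number of common ancestors of positive level. -/
def common (u x : V) : ℕ := (D.anc u ∩ D.anc x).card

theorem common_self (x : V) : D.common x x = D.lev x := by
  rw [common, Finset.inter_self, card_anc]

theorem common_le_left (u x : V) : D.common u x ≤ D.lev u :=
  (Finset.card_le_card Finset.inter_subset_left).trans_eq (D.card_anc u)

theorem common_of_lev_eq_zero_right (u : V) {x : V} (hx : D.lev x = 0) : D.common u x = 0 := by
  simp [common, D.anc_of_lev_eq_zero hx]

theorem common_of_lev_eq_zero_left {u : V} (x : V) (hu : D.lev u = 0) : D.common u x = 0 := by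
  simp [common, D.anc_of_lev_eq_zero hu]

theorem common_par_le (u : V) {x : V} (hx : D.lev x ≠ 0) :
    D.common u (D.par x) ≤ D.common u x := by
  rw [common, common, D.anc_eq_insert hx]
  exact Finset.card_le_card (Finset.inter_subset_inter_left (Finset.subset_insert _ _))

theorem common_le_par_add_one (u : V) {x : V} (hx : D.lev x ≠ 0) :
    D.common u x ≤ D.common u (D.par x) + 1 := by
  rw [common, common, D.anc_eq_insert hx]
  refine (Finset.card_le_card ?_).trans (Finset.card_insert_le x _)
  intro y
  simp only [Finset.mem_inter, Finset.mem_insert]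
  tauto

theorem le_length_add_common (u : V) {x y : V} (p : G.Walk x y) :
    D.lev y + (if D.side u = D.side y then 0 else 1) + 2 * D.common u x ≤
      p.length + D.lev x + (if D.side u = D.side x then 0 else 1) + 2 * D.common u y := by
  induction p with
  | nil => simp
  | @cons x z y hxz p ih =>
    rw [Walk.length_cons]
    rcases D.adj_cases x z hxz with ⟨hx, rfl⟩ | ⟨hz, rfl⟩ | ⟨hx, hz, hs⟩
    · have h1 := D.lev_par x hx
      have h2 := D.common_le_par_add_one u hx
      rw [D.side_par x hx] at ih
      omega
    · have h1 := D.lev_par z hz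
      have h2 := D.common_par_le u hz
      rw [D.side_par z hz]
      omega
    · have h1 := D.common_of_lev_eq_zero_right u hx
      have h2 := D.common_of_lev_eq_zero_right u hz
      have h3 : (if D.side u = D.side z then 0 else 1) ≤ 1 := by split_ifs <;> simp
      omega

theorem lev_add_lev_le (hG : G.Connected) (u x : V) :
    D.lev u + D.lev x + (if D.side u = D.side x then 0 else 1) ≤
      G.dist u x + 2 * D.common u x := by
  obtain ⟨p, hp⟩ := hG.exists_walk_length_eq_dist u x
  have h1 := D.le_length_add_common u p
  rw [D.common_self, if_pos (rfl : D.side u = D.side u), hp] at h1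
  omega

theorem dist_par (x : V) (hx : D.lev x ≠ 0) : G.dist x (D.par x) = 1 :=
  dist_eq_one_iff_adj.2 (D.adj_par x hx)

theorem dist_iterate_par_le (hG : G.Connected) (x : V) (k : ℕ) (hk : k ≤ D.lev x) :
    G.dist x (D.par^[k] x) ≤ k := by
  induction k with
  | zero => simp
  | succ k ih =>
    have h1 := D.lev_iterate_par x k (by omega)
    have h2 := D.dist_par (D.par^[k] x) (by omega)
    have h3 : G.dist x (D.par^[k + 1] x) ≤ _ := hG.dist_triangle (v := D.par^[k] x)
    rw [Function.iterate_succ_apply'] at h3 ⊢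
    have h4 := ih (by omega)
    omega

theorem side_iterate_par (x : V) (k : ℕ) (hk : k ≤ D.lev x) :
    D.side (D.par^[k] x) = D.side x := by
  induction k with
  | zero => rfl
  | succ k ih =>
    have h1 := D.lev_iterate_par x k (by omega)
    rw [Function.iterate_succ_apply', D.side_par _ (by omega), ih (by omega)]

theorem dist_c_le (hG : G.Connected) (x : V) : G.dist x (D.c (D.side x)) ≤ D.lev x := by
  have h1 := D.dist_iterate_par_le hG x (D.lev x) le_rfl
  have h2 := D.lev_iterate_par x (D.lev x) le_rfl
  rwa [D.eq_c (D.par^[D.lev x] x) (by omega), D.side_iterate_par x _ le_rfl] at h1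

theorem dist_c_c_le (s t : Bool) : G.dist (D.c s) (D.c t) ≤ 1 := by
  have h1 := dist_eq_one_iff_adj.2 D.adj_c
  have h2 := dist_eq_one_iff_adj.2 D.adj_c.symm
  cases s <;> cases t <;> simp [h1, h2]

theorem dist_le_lev_add_lev_add_one (hG : G.Connected) (x y : V) :
    G.dist x y ≤ D.lev x + D.lev y + 1 := by
  have h1 : G.dist x y ≤ _ := hG.dist_triangle (v := D.c (D.side x))
  have h2 := D.dist_c_le hG x
  have h3 := D.dist_c_le hG y
  have h4 : G.dist (D.c (D.side x)) y ≤ _ := hG.dist_triangle (v := D.c (D.side y))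
  have h5 := D.dist_c_c_le (D.side x) (D.side y)
  rw [dist_comm] at h3
  omega

theorem eq_of_lev_eq_one (hh : 1 ≤ h) (hm0 : m 0 = 2) {x y : V} (hx : D.lev x = 1)
    (hy : D.lev y = 1) (hs : D.side x = D.side y) : x = y := by
  have h1 := D.card_children (D.c (D.side x)) (by rw [D.lev_c]; omega)
  rw [D.lev_c, hm0] at h1
  refine Finset.card_le_one.1 h1.le x ?_ y ?_
  · simp [hx, D.par_eq_c_of_lev_eq_one hx]
  · simp [hy, D.par_eq_c_of_lev_eq_one hy, hs]

theorem dist_add_two_le (hG : G.Connected) (hh : 1 ≤ h) (hm0 : m 0 = 2) {x y : V}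
    (hx : D.lev x ≠ 0) (hy : D.lev y ≠ 0) (hs : D.side x = D.side y) :
    G.dist x y + 2 ≤ D.lev x + D.lev y := by
  have h1 := D.dist_iterate_par_le hG x (D.lev x - 1) (by omega)
  have h2 := D.dist_iterate_par_le hG y (D.lev y - 1) (by omega)
  have h3 := D.lev_iterate_par x (D.lev x - 1) (by omega)
  have h4 := D.lev_iterate_par y (D.lev y - 1) (by omega)
  have h5 := D.eq_of_lev_eq_one hh hm0 (x := D.par^[D.lev x - 1] x) (y := D.par^[D.lev y - 1] y)
    (by omega) (by omega)
    (by rw [D.side_iterate_par x _ (by omega), D.side_iterate_par y _ (by omega), hs])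
  rw [← h5, dist_comm] at h2
  have h6 : G.dist x y ≤ _ := hG.dist_triangle (v := D.par^[D.lev x - 1] x)
  omega

theorem card_lev_eq {i : ℕ} (hi : i ≤ h) :
    (Finset.univ.filter fun x => D.lev x = i).card = 2 * levelCount m i := by
  induction i with
  | zero =>
    have h1 : (Finset.univ.filter fun x => D.lev x = 0) = {D.c false, D.c true} := by
      ext x
      simp only [Finset.mem_filter, Finset.mem_univ, true_and, Finset.mem_insert,
        Finset.mem_singleton]
      constructor
      · intro hx
        have := D.eq_c x hx
        cases hs : D.side x <;> rw [hs] at this <;> tauto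
      · rintro (rfl | rfl) <;> exact D.lev_c _
    rw [h1, Finset.card_pair D.adj_c.ne]
    simp [levelCount]
  | succ i ih =>
    rw [Finset.card_eq_sum_card_fiberwise (f := D.par)
      (t := Finset.univ.filter fun x => D.lev x = i)]
    · rw [Finset.sum_const_nat (m := m i - 1), ih (by omega), levelCount_succ, mul_assoc]
      intro x hx
      have hx' : D.lev x = i := by simpa using hx
      rw [← hx', ← D.card_children x (by omega), Finset.filter_filter]
      congr 1
      ext y
      simp only [Finset.mem_filter, Finset.mem_univ, true_and]
      constructor
      · rintro ⟨h1, h2⟩; exact ⟨by omega, h2⟩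
      · rintro ⟨h1, h2⟩
        have := D.lev_par y h1
        rw [h2] at this
        exact ⟨by omega, h2⟩
    · intro x hx
      have hx' : D.lev x = i + 1 := by simpa using hx
      have := D.lev_par x (by omega)
      simp only [Finset.coe_filter, Finset.mem_univ, true_and, Set.mem_ofPred_eq]
      omega

theorem sum_lev {M : Type*} [AddCommMonoid M] (g : ℕ → M) :
    ∑ x, g (D.lev x) = ∑ i ∈ Finset.range (h + 1), (2 * levelCount m i) • g i := by
  rw [← Finset.sum_fiberwise_of_maps_to (s := Finset.univ) (t := Finset.range (h + 1))
    (g := D.lev) (fun x _ => Finset.mem_range.2 (Nat.lt_succ_of_le (D.lev_le x)))]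
  refine Finset.sum_congr rfl fun i hi => ?_
  rw [← D.card_lev_eq (Nat.lt_succ_iff.1 (Finset.mem_range.1 hi)), ← Finset.sum_const]
  refine Finset.sum_congr rfl fun x hx => ?_
  rw [(Finset.mem_filter.1 hx).2]

theorem exists_child (x : V) (hx : D.lev x < h) : ∃ f : ℕ → V,
    (∀ d < m (D.lev x) - 1, D.lev (f d) = D.lev x + 1 ∧ D.par (f d) = x) ∧
    (∀ d < m (D.lev x) - 1, ∀ e < m (D.lev x) - 1, f d = f e → d = e) ∧
    ∀ y, D.lev y ≠ 0 → D.par y = x → ∃ d < m (D.lev x) - 1, f d = y := by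
  let e := Finset.equivFinOfCardEq (D.card_children x hx)
  refine ⟨fun d => if hd : d < m (D.lev x) - 1 then (e.symm ⟨d, hd⟩ : V) else x, ?_, ?_, ?_⟩
  · intro d hd
    have h1 := (e.symm ⟨d, hd⟩).2
    rw [Finset.mem_filter] at h1
    have h2 := D.lev_par _ h1.2.1
    simp only [dif_pos hd]
    rw [h1.2.2] at h2
    exact ⟨h2.symm, h1.2.2⟩
  · intro d hd d' hd' hdd
    simp only [dif_pos hd, dif_pos hd'] at hdd
    simpa using e.symm.injective (Subtype.ext hdd)
  · intro y hy hyx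
    have hmem : y ∈ Finset.univ.filter fun y => D.lev y ≠ 0 ∧ D.par y = x := by simp [hy, hyx]
    refine ⟨e ⟨y, hmem⟩, (e ⟨y, hmem⟩).2, ?_⟩
    simp

/-- An enumeration of the children of `x`. -/
noncomputable def child (x : V) : ℕ → V :=
  if hx : D.lev x < h then (D.exists_child x hx).choose else fun _ => x

theorem child_spec {x : V} (hx : D.lev x < h) :
    (∀ d < m (D.lev x) - 1, D.lev (D.child x d) = D.lev x + 1 ∧ D.par (D.child x d) = x) ∧
    (∀ d < m (D.lev x) - 1, ∀ e < m (D.lev x) - 1, D.child x d = D.child x e → d = e) ∧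
    ∀ y, D.lev y ≠ 0 → D.par y = x → ∃ d < m (D.lev x) - 1, D.child x d = y := by
  rw [child, dif_pos hx]
  exact (D.exists_child x hx).choose_spec

/-- The vertex on side `s` at level `i` addressed by the first `i` mixed radix digits of `q`, least
significant digit first. -/
noncomputable def vtx (s : Bool) : ℕ → ℕ → V
  | 0, _ => D.c s
  | i + 1, q => D.child (vtx s i q) (q / levelCount m i % (m i - 1))

theorem lev_vtx (hm : ∀ i < h, 2 ≤ m i) (s : Bool) {i : ℕ} (hi : i ≤ h) (q : ℕ) :
    D.lev (D.vtx s i q) = i := by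
  induction i with
  | zero => exact D.lev_c s
  | succ i ih =>
    have h1 := ih (by omega)
    have h2 := hm i hi
    have h3 := (D.child_spec (x := D.vtx s i q) (by omega)).1
    rw [h1] at h3
    exact (h3 _ (Nat.mod_lt _ (by omega))).1

theorem par_vtx (hm : ∀ i < h, 2 ≤ m i) (s : Bool) {i : ℕ} (hi : i < h) (q : ℕ) :
    D.par (D.vtx s (i + 1) q) = D.vtx s i q := by
  have h1 := D.lev_vtx hm s hi.le q
  have h2 := hm i hi
  have h3 := (D.child_spec (x := D.vtx s i q) (by omega)).1
  rw [h1] at h3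
  exact (h3 _ (Nat.mod_lt _ (by omega))).2

theorem side_vtx (hm : ∀ i < h, 2 ≤ m i) (s : Bool) {i : ℕ} (hi : i ≤ h) (q : ℕ) :
    D.side (D.vtx s i q) = s := by
  induction i with
  | zero => exact D.side_c s
  | succ i ih =>
    have h1 := D.lev_vtx hm s hi q
    rw [← D.side_par _ (by omega), D.par_vtx hm s hi, ih (by omega)]

theorem vtx_congr (s : Bool) {i q q' : ℕ} (hq : q ≡ q' [MOD levelCount m i]) :
    D.vtx s i q = D.vtx s i q' := by
  induction i with
  | zero => rfl
  | succ i ih =>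
    rw [levelCount_succ] at hq
    rw [vtx, vtx, ih (hq.of_mul_right _)]
    congr 1
    have h1 : q % levelCount m i = q' % levelCount m i := hq.of_mul_right _
    have h2 : q % _ = q' % _ := hq
    rw [Nat.mod_mul, Nat.mod_mul, h1] at h2
    rcases Nat.eq_zero_or_pos (levelCount m i) with h0 | h0
    · simp [h0]
    · exact Nat.eq_of_mul_eq_mul_left h0 (Nat.add_left_cancel h2)

theorem modEq_of_vtx_eq (hm : ∀ i < h, 2 ≤ m i) (s : Bool) {i q q' : ℕ} (hi : i ≤ h)
    (hq : D.vtx s i q = D.vtx s i q') : q ≡ q' [MOD levelCount m i] := by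
  induction i with
  | zero => simp [levelCount, Nat.modEq_one]
  | succ i ih =>
    have h1 := D.par_vtx hm s hi q
    rw [hq, D.par_vtx hm s hi q'] at h1
    have h2 := ih (by omega) h1.symm
    rw [vtx, vtx, ← h1] at hq
    have h3 := D.lev_vtx hm s (i := i) (by omega) q'
    have h4 := (D.child_spec (x := D.vtx s i q') (by omega)).2.1
    rw [h3] at h4
    have h5 := hm i hi
    have h6 := h4 _ (Nat.mod_lt _ (by omega)) _ (Nat.mod_lt _ (by omega)) hq
    have h7 : q % levelCount m i = q' % levelCount m i := h2
    rw [levelCount_succ]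
    change q % _ = q' % _
    rw [Nat.mod_mul, Nat.mod_mul, h6, h7]

theorem exists_vtx_eq (hm : ∀ i < h, 2 ≤ m i) (x : V) : ∃ q, D.vtx (D.side x) (D.lev x) q = x := by
  induction hi : D.lev x generalizing x with
  | zero => exact ⟨0, (D.eq_c x hi).symm⟩
  | succ i ih =>
    have h1 := D.lev_par x (by omega)
    have h2 := D.lev_le x
    obtain ⟨q, hq⟩ := ih (D.par x) (by omega)
    rw [D.side_par x (by omega)] at hq
    obtain ⟨d, hd, hdx⟩ :=
      (D.child_spec (x := D.par x) (by omega)).2.2 x (by omega) rfl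
    have h3 : D.lev (D.par x) = i := by omega
    rw [h3] at hd
    have hN : 0 < levelCount m i := Finset.prod_pos fun j hj => by
      have := hm j (by have := Finset.mem_range.1 hj; omega)
      omega
    refine ⟨q % levelCount m i + levelCount m i * d, ?_⟩
    have h4 : q % levelCount m i + levelCount m i * d ≡ q [MOD levelCount m i] := by
      simp [Nat.ModEq]
    rw [vtx, D.vtx_congr _ h4, hq, Nat.add_mul_div_left _ _ hN,
      Nat.div_eq_of_lt (Nat.mod_lt _ hN), Nat.zero_add, Nat.mod_eq_of_lt hd, hdx]

theorem iterate_par_vtx (hm : ∀ i < h, 2 ≤ m i) (s : Bool) {i : ℕ} (hi : i ≤ h) (q k : ℕ)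
    (hk : k ≤ i) :
    D.par^[k] (D.vtx s i q) = D.vtx s (i - k) q := by
  induction k with
  | zero => rfl
  | succ k ih =>
    rw [Function.iterate_succ_apply', ih (by omega)]
    have : i - k = (i - (k + 1)) + 1 := by omega
    rw [this, D.par_vtx hm s (by omega)]

theorem exists_of_mem_anc_vtx (hm : ∀ i < h, 2 ≤ m i) {s : Bool} {i q : ℕ} (hi : i ≤ h) {y : V}
    (hy : y ∈ D.anc (D.vtx s i q)) : ∃ r, 1 ≤ r ∧ r ≤ i ∧ D.vtx s r q = y := by
  rw [anc, Finset.mem_image, D.lev_vtx hm s hi] at hy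
  obtain ⟨k, hk, rfl⟩ := hy
  have hk := Finset.mem_range.1 hk
  exact ⟨i - k, by omega, by omega, (D.iterate_par_vtx hm s hi q k hk.le).symm⟩

theorem common_vtx_le (hm : ∀ i < h, 2 ≤ m i) (hN : ∀ i ≤ h, i ≤ levelCount m i) (s : Bool)
    {i i' q q' : ℕ} (hi : i ≤ h)
    (hi' : i' ≤ h) (hq : q < q') : D.common (D.vtx s i q) (D.vtx s i' q') ≤ q' - q := by
  have hsub : D.anc (D.vtx s i q) ∩ D.anc (D.vtx s i' q') ⊆
      (Finset.Icc 1 (q' - q)).image fun r => D.vtx s r q := by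
    intro y hy
    rw [Finset.mem_inter] at hy
    obtain ⟨r, hr1, hr2, hr⟩ := D.exists_of_mem_anc_vtx hm hi hy.1
    obtain ⟨r', hr1', hr2', hr'⟩ := D.exists_of_mem_anc_vtx hm hi' hy.2
    have h1 := D.lev_vtx hm s (hr2.trans hi) q
    have h2 := D.lev_vtx hm s (hr2'.trans hi') q'
    rw [hr] at h1
    rw [hr', h1] at h2
    subst h2
    have h3 := D.modEq_of_vtx_eq hm s (hr2.trans hi) (hr.trans hr'.symm)
    have h4 := Nat.le_of_dvd (by omega) ((Nat.modEq_iff_dvd' hq.le).1 h3)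
    have h5 := hN r (hr2.trans hi)
    exact Finset.mem_image.2 ⟨r, Finset.mem_Icc.2 ⟨hr1, by omega⟩, hr⟩
  calc D.common _ _ ≤ _ := Finset.card_le_card hsub
    _ ≤ _ := Finset.card_image_le
    _ = q' - q := by simp

theorem gdiam_eq (hm : ∀ i < h, 2 ≤ m i) (D : BiRooted G h m) (hG : G.Connected) :
    gdiam G = 2 * h + 1 := by
  apply le_antisymm
  · refine Finset.sup_le fun p _ => ?_
    have h1 := D.dist_le_lev_add_lev_add_one hG p.1 p.2
    have h2 := D.lev_le p.1
    have h3 := D.lev_le p.2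
    omega
  · have h1 := D.lev_add_lev_le hG (D.vtx false h 0) (D.vtx true h 0)
    have h2 : D.common (D.vtx false h 0) (D.vtx true h 0) = 0 := by
      rw [common, Finset.card_eq_zero, Finset.eq_empty_iff_forall_notMem]
      intro y hy
      rw [Finset.mem_inter] at hy
      obtain ⟨r, -, hr2, rfl⟩ := D.exists_of_mem_anc_vtx hm le_rfl hy.1
      obtain ⟨r', -, hr2', hr'⟩ := D.exists_of_mem_anc_vtx hm le_rfl hy.2
      have h3 := D.side_vtx hm true hr2' 0
      rw [hr', D.side_vtx hm false hr2] at h3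
      cases h3
    rw [D.lev_vtx hm _ le_rfl, D.lev_vtx hm _ le_rfl, D.side_vtx hm _ le_rfl,
      D.side_vtx hm _ le_rfl, h2] at h1
    have h3 : G.dist (D.vtx false h 0) (D.vtx true h 0) ≤ gdiam G :=
      Finset.le_sup (f := fun pr : V × V => G.dist pr.1 pr.2)
        (Finset.mem_univ (D.vtx false h 0, D.vtx true h 0))
    simp at h1
    omega

end BiRooted

theorem sum_enumeration {M : Type*} [AddCommMonoid M] {u : ℕ → V}
    (hu : ∀ v, ∃ t < Fintype.card V, u t = v) (g : V → M) :
    ∑ t ∈ Finset.range (Fintype.card V), g (u t) = ∑ v, g v := by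
  have hbij : Function.Bijective fun t : Fin (Fintype.card V) => u t := by
    rw [Fintype.bijective_iff_surjective_and_card]
    refine ⟨fun v => ?_, by simp⟩
    obtain ⟨t, ht, rfl⟩ := hu v
    exact ⟨⟨t, ht⟩, rfl⟩
  rw [← hbij.sum_comp g, ← Fin.sum_univ_eq_sum_range fun t => g (u t)]

theorem exists_increasing_enumeration [Nonempty V] {f : V → ℕ} (hf : Function.Injective f) :
    ∃ u : ℕ → V, (∀ i j, i < j → j < Fintype.card V → f (u i) < f (u j)) ∧
      ∀ v, ∃ t < Fintype.card V, u t = v := by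
  have hcard : (Finset.univ.image f).card = Fintype.card V :=
    Finset.card_image_of_injective _ hf
  let e := (Finset.univ.image f).orderEmbOfFin hcard
  have he : ∀ t, ∃ v, f v = e t := fun t => by
    obtain ⟨v, -, hv⟩ := Finset.mem_image.1 (Finset.orderEmbOfFin_mem _ hcard t)
    exact ⟨v, hv⟩
  choose w hw using he
  refine ⟨fun t => if ht : t < Fintype.card V then w ⟨t, ht⟩ else Classical.arbitrary V, ?_, ?_⟩
  · intro i j hij hj
    simp only [dif_pos hj, dif_pos (hij.trans hj), hw]
    exact e.strictMono hij
  · intro v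
    have hv : f v ∈ Set.range e := by
      rw [Finset.range_orderEmbOfFin]; simp
    obtain ⟨t, ht⟩ := hv
    refine ⟨t, t.2, ?_⟩
    simp only [dif_pos t.2]
    exact hf (by rw [hw, ht])

namespace BiRooted

variable {G : SimpleGraph V} {h : ℕ} {m : ℕ → ℕ}

/-- The radio number of the graph, in terms of the order, the total level and the leaves. -/
def optimum (D : BiRooted G h m) : ℤ :=
  ((Fintype.card V : ℤ) - 1) * (2 * h + 1) - 2 * ∑ x, (D.lev x : ℤ)
    + (Finset.univ.filter fun x => D.lev x = h).card - 2

theorem optimum_le_span (D : BiRooted G h m) (hG : G.Connected) (hh : 1 ≤ h) (hm0 : m 0 = 2)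
    (hdiam : gdiam G = 2 * h + 1) {f : V → ℕ} (hf : IsRadioLabelling G f) :
    D.optimum ≤ span f := by
  have hinj : Function.Injective f := by
    intro x y hxy
    by_contra hne
    have h1 := hf x y hne
    have h2 := D.dist_le_lev_add_lev_add_one hG x y
    have h3 := D.lev_le x
    have h4 := D.lev_le y
    rw [hxy, hdiam] at h1
    simp at h1
    omega
  have : Nonempty V := hG.nonempty
  obtain ⟨u, hmono, hsurj⟩ := exists_increasing_enumeration hinj
  obtain ⟨P, hP⟩ : ∃ P, Fintype.card V = P + 2 := by
    have : 1 < Fintype.card V := Fintype.one_lt_card_iff.2 ⟨_, _, D.adj_c.ne⟩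
    exact ⟨Fintype.card V - 2, by omega⟩
  have hradio : ∀ i j, i < j → j < P + 2 →
      2 * (h : ℤ) + 2 ≤ f (u j) - f (u i) + G.dist (u i) (u j) := by
    intro i j hij hj
    have h1 := hmono i j hij (by omega)
    have h2 := hf (u i) (u j) (fun e => by rw [e] at h1; exact lt_irrefl _ h1)
    rw [abs_sub_comm, abs_of_nonneg (by omega), hdiam] at h2
    push_cast at h2
    linarith
  set l : ℕ → ℤ := fun t => D.lev (u t) with hl
  set E : ℕ → ℤ := fun t => f (u (t + 1)) - f (u t) - (2 * h + 1) + l t + l (t + 1) with hE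
  set a : ℕ → ℤ := fun t => if D.lev (u t) = 0 then 1 else 0 with ha
  set b : ℕ → ℤ := fun t => if D.lev (u t) = h then 1 else 0 with hb
  have hE0 : ∀ t < P + 1, 0 ≤ E t := by
    intro t ht
    have h1 := hradio t (t + 1) (by omega) (by omega)
    have h2 := D.dist_le_lev_add_lev_add_one hG (u t) (u (t + 1))
    simp only [hE, hl]
    omega
  have hEsame : ∀ t < P + 1, D.lev (u t) ≠ 0 → D.lev (u (t + 1)) ≠ 0 →
      D.side (u t) = D.side (u (t + 1)) → 2 ≤ E t := by
    intro t ht hx hy hs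
    have h1 := hradio t (t + 1) (by omega) (by omega)
    have h2 := D.dist_add_two_le hG hh hm0 hx hy hs
    simp only [hE, hl]
    omega
  have hEE : ∀ t < P, 2 * (b (t + 1) - a t - a (t + 2)) ≤ E t + E (t + 1) := by
    intro t ht
    have e0 := hE0 t (by omega)
    have e1 := hE0 (t + 1) (by omega)
    by_cases c1 : D.lev (u (t + 1)) = h
    swap
    · simp only [hb, ha, if_neg c1]
      split_ifs <;> linarith
    by_cases c2 : D.lev (u t) = 0
    · simp only [hb, ha, if_pos c1, if_pos c2]
      split_ifs <;> linarith
    by_cases c3 : D.lev (u (t + 2)) = 0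
    · simp only [hb, ha, if_pos c1, if_neg c2, if_pos c3]
      linarith
    simp only [hb, ha, if_pos c1, if_neg c2, if_neg c3]
    by_cases s1 : D.side (u t) = D.side (u (t + 1))
    · have := hEsame t (by omega) c2 (by omega) s1
      linarith
    by_cases s2 : D.side (u (t + 1)) = D.side (u (t + 2))
    · have := hEsame (t + 1) (by omega) (by omega) c3 s2
      linarith
    have s3 : D.side (u t) = D.side (u (t + 2)) := by
      rw [Bool.eq_not_of_ne s1, Bool.eq_not_of_ne s2, Bool.not_not]
    have h1 := D.dist_add_two_le hG hh hm0 c2 c3 s3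
    have h2 := hradio t (t + 2) (by omega) (by omega)
    simp only [hE, hl]
    rw [show t + 1 + 1 = t + 2 from rfl, c1]
    omega
  have hsplit : ∀ g : ℕ → ℤ, ∑ t ∈ Finset.range (P + 1), (g t + g (t + 1)) =
      2 * ∑ t ∈ Finset.range (P + 2), g t - g 0 - g (P + 1) := by
    intro g
    rw [Finset.sum_add_distrib]
    have h1 := Finset.sum_range_succ g (P + 1)
    have h2 := Finset.sum_range_succ' g (P + 1)
    rw [show P + 1 + 1 = P + 2 from rfl] at h1 h2
    linarith
  have hsumE : ∑ t ∈ Finset.range P, (E t + E (t + 1)) =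
      2 * ∑ t ∈ Finset.range (P + 1), E t - E 0 - E P := by
    rw [Finset.sum_add_distrib]
    have h1 := Finset.sum_range_succ E P
    have h2 := Finset.sum_range_succ' E P
    linarith
  have hmid : ∑ t ∈ Finset.range P, (2 * (b (t + 1) - a t - a (t + 2))) =
      2 * (∑ t ∈ Finset.range (P + 2), b t - b 0 - b (P + 1)
        - (∑ t ∈ Finset.range (P + 2), a t - a P - a (P + 1))
        - (∑ t ∈ Finset.range (P + 2), a t - a 0 - a 1)) := by
    rw [← Finset.mul_sum, Finset.sum_sub_distrib, Finset.sum_sub_distrib]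
    have h1 := Finset.sum_range_succ b (P + 1)
    have h2 := Finset.sum_range_succ' b P
    have h3 := Finset.sum_range_succ a (P + 1)
    have h4 := Finset.sum_range_succ a P
    have h5 := Finset.sum_range_succ' a (P + 1)
    have h6 := Finset.sum_range_succ' (fun t => a (t + 1)) P
    simp only [add_assoc, Nat.reduceAdd, zero_add] at h1 h2 h3 h4 h5 h6
    linarith
  have htel : ∑ t ∈ Finset.range (P + 1), E t = f (u (P + 1)) - f (u 0)
      - (P + 1) * (2 * h + 1) + ∑ t ∈ Finset.range (P + 1), (l t + l (t + 1)) := by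
    have h1 := Finset.sum_range_sub (fun t => (f (u t) : ℤ)) (P + 1)
    rw [← h1, eq_comm]
    have h2 : ((P : ℤ) + 1) * (2 * h + 1) = ∑ t ∈ Finset.range (P + 1), (2 * (h : ℤ) + 1) := by
      simp
    rw [h2, ← Finset.sum_sub_distrib, ← Finset.sum_add_distrib]
    refine Finset.sum_congr rfl fun t _ => ?_
    simp only [hE]
    ring
  have hsuml : ∑ t ∈ Finset.range (P + 2), l t = ∑ x, (D.lev x : ℤ) := by
    rw [← hP]; exact sum_enumeration hsurj fun x => (D.lev x : ℤ)
  have hsumb : ∑ t ∈ Finset.range (P + 2), b t =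
      (Finset.univ.filter fun x => D.lev x = h).card := by
    rw [← hP, sum_enumeration hsurj fun x => (if D.lev x = h then (1 : ℤ) else 0)]
    simp
  have hsuma : ∑ t ∈ Finset.range (P + 2), a t = 2 := by
    rw [← hP, sum_enumeration hsurj fun x => (if D.lev x = 0 then (1 : ℤ) else 0)]
    have := D.card_lev_eq (Nat.zero_le h)
    simp only [Finset.sum_boole, this]
    simp [levelCount]
  have hspan : (f (u (P + 1)) : ℤ) - f (u 0) ≤ span f := by
    have : f (u (P + 1)) - f (u 0) ≤ span f :=
      Finset.le_sup (f := fun pr : V × V => f pr.1 - f pr.2) (Finset.mem_univ (u (P + 1), u 0))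
    omega
  have hge := Finset.sum_le_sum fun t (ht : t ∈ Finset.range P) => hEE t (Finset.mem_range.1 ht)
  have hends : ((Finset.univ.filter fun x => D.lev x = h).card : ℤ) - 2 ≤
      ∑ t ∈ Finset.range (P + 1), E t + l 0 + l (P + 1) := by
    have hl0 : ∀ t, 0 ≤ l t := fun t => Int.natCast_nonneg _
    rcases hh.eq_or_lt with h1 | h1
    · have h2 := D.card_lev_eq (i := h) le_rfl
      have h3 : levelCount m h = 1 := by rw [← h1]; simp [levelCount, hm0]
      rw [h2, h3]
      have h4 : 0 ≤ ∑ t ∈ Finset.range (P + 1), E t :=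
        Finset.sum_nonneg fun t ht => hE0 t (Finset.mem_range.1 ht)
      have h5 := hl0 0
      have h6 := hl0 (P + 1)
      push_cast
      linarith
    · have hend : ∀ t, 1 ≤ l t - b t + a t := by
        intro t
        simp only [hl, ha, hb]
        split_ifs <;> omega
      have ha0 : ∀ t, 0 ≤ a t := by
        intro t
        simp only [ha]
        split_ifs <;> simp
      have h2 := hend 0
      have h3 := hend (P + 1)
      have h4 := ha0 1
      have h5 := ha0 P
      have h6 := hE0 0 (by omega)
      have h7 := hE0 P (by omega)
      rw [hsumE, hmid, hsuma, hsumb] at hge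
      linarith
  have hl2 := hsplit l
  rw [optimum, hP, ← hsuml]
  push_cast
  linarith

end BiRooted

/-- The number of vertices on one side at level at least `i`. -/
def tailCount (h : ℕ) (m : ℕ → ℕ) (i : ℕ) : ℕ := ∑ r ∈ Finset.Ico i (h + 1), levelCount m r

theorem tailCount_succ_add {h : ℕ} (m : ℕ → ℕ) {i : ℕ} (hi : i ≤ h) :
    tailCount h m (i + 1) + levelCount m i = tailCount h m i := by
  rw [tailCount, tailCount, Finset.sum_eq_sum_Ico_succ_bot (Nat.lt_succ_of_le hi), add_comm]

theorem tailCount_self (h : ℕ) (m : ℕ → ℕ) : tailCount h m h = levelCount m h := by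
  simp [tailCount]

theorem tailCount_anti (h : ℕ) (m : ℕ → ℕ) : Antitone (tailCount h m) := fun _ _ hij =>
  Finset.sum_le_sum_of_subset (Finset.Ico_subset_Ico_left hij)

theorem levelCount_dvd_tailCount (h : ℕ) (m : ℕ → ℕ) (i : ℕ) :
    levelCount m i ∣ tailCount h m (i + 1) :=
  Finset.dvd_sum fun r hr => Finset.prod_dvd_prod_of_subset _ _ _
    (Finset.range_subset_range.2 (by have := Finset.mem_Ico.1 hr; omega))

theorem tailCount_add_le {h : ℕ} {m : ℕ → ℕ} (hN : ∀ i ≤ h, i ≤ levelCount m i) {i : ℕ}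
    (hi : 1 ≤ i) (hih : i ≤ h) : tailCount h m i + i ≤ tailCount h m 1 + 1 := by
  induction i, hi using Nat.le_induction with
  | base => rfl
  | succ i hi ih =>
    have h1 := ih (by omega)
    have h2 := tailCount_succ_add m (i := i) (h := h) (by omega)
    have h3 := hN i (by omega)
    omega

/-- The level of the `q`-th vertex when the vertices of one side are listed by decreasing level. -/
def listLevel (h : ℕ) (m : ℕ → ℕ) (q : ℕ) : ℕ := Nat.findGreatest (fun i => q < tailCount h m i) h

theorem listLevel_le (h : ℕ) (m : ℕ → ℕ) (q : ℕ) : listLevel h m q ≤ h := Nat.findGreatest_le h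

theorem one_le_listLevel {h : ℕ} {m : ℕ → ℕ} {q : ℕ} (hh : 1 ≤ h) (hq : q < tailCount h m 1) :
    1 ≤ listLevel h m q := Nat.le_findGreatest hh hq

theorem lt_tailCount_listLevel {h : ℕ} {m : ℕ → ℕ} {q : ℕ} (hq : listLevel h m q ≠ 0) :
    q < tailCount h m (listLevel h m q) :=
  Nat.findGreatest_of_ne_zero (P := fun i => q < tailCount h m i) rfl hq

theorem listLevel_eq {h : ℕ} {m : ℕ → ℕ} {q i : ℕ} (hi : i ≤ h)
    (hq : tailCount h m (i + 1) ≤ q) (hq' : q < tailCount h m i) : listLevel h m q = i := by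
  rw [listLevel, Nat.findGreatest_eq_iff]
  refine ⟨hi, fun _ => hq', fun j hj _ hjq => ?_⟩
  have := tailCount_anti h m (show i + 1 ≤ j from hj)
  omega

/-- The `t`-th label of the labelling in which consecutive labels differ by
`2 * h + 1 + E s - (l s + l (s + 1))`, for a sequence of levels `l` and one of surpluses `E`. -/
def labelSum (h : ℕ) (l E : ℕ → ℕ) (t : ℕ) : ℕ :=
  ∑ s ∈ Finset.range t, (2 * h + 1 + E s - (l s + l (s + 1)))

theorem labelSum_succ {h : ℕ} {l : ℕ → ℕ} (hl : ∀ t, l t ≤ h) (E : ℕ → ℕ) (t : ℕ) :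
    labelSum h l E (t + 1) + l t + l (t + 1) = labelSum h l E t + (2 * h + 1) + E t := by
  rw [labelSum, Finset.sum_range_succ, labelSum]
  have h1 := hl t
  have h2 := hl (t + 1)
  omega

theorem le_labelSum_add {h : ℕ} {l : ℕ → ℕ} (hl : ∀ t, l t ≤ h) (E : ℕ → ℕ) (i k : ℕ) :
    labelSum h l E i + (2 * h + 1) + k ≤ labelSum h l E (i + k + 1) + l i + l (i + k + 1) := by
  induction k with
  | zero =>
    have := labelSum_succ hl E i
    simp only [add_zero]
    omega
  | succ k ih =>
    have h1 := labelSum_succ hl E (i + k + 1)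
    have h2 := hl (i + k + 1)
    rw [show i + (k + 1) + 1 = i + k + 1 + 1 by ring]
    omega

theorem le_labelSum_add_of_surplus {h : ℕ} {l : ℕ → ℕ} (hl : ∀ t, l t ≤ h) (E : ℕ → ℕ) (i k : ℕ)
    (hE : 2 * l (i + 1) + 2 ≤ 2 * h + E i + E (i + 1)) :
    labelSum h l E i + (2 * h + 1) + k + 3 ≤
      labelSum h l E (i + k + 2) + l i + l (i + k + 2) := by
  induction k with
  | zero =>
    have h1 := labelSum_succ hl E i
    have h2 := labelSum_succ hl E (i + 1)
    rw [show i + 1 + 1 = i + 2 from rfl] at h2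
    simp only [add_zero]
    omega
  | succ k ih =>
    have h1 := labelSum_succ hl E (i + k + 2)
    have h2 := hl (i + k + 2)
    rw [show i + (k + 1) + 2 = i + k + 2 + 1 by ring]
    omega

/-- The level of the `q`-th slot: the list of one side by decreasing level, with an additional
leaf at the end. -/
def slotLevel (h : ℕ) (m : ℕ → ℕ) (q : ℕ) : ℕ :=
  if q = tailCount h m 1 then h else listLevel h m q

theorem slotLevel_le (h : ℕ) (m : ℕ → ℕ) (q : ℕ) : slotLevel h m q ≤ h := by
  rw [slotLevel]; split_ifs
  · rfl
  · exact listLevel_le h m q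

/-- The levels along the optimal order. -/
def orderLevel (h : ℕ) (m : ℕ → ℕ) (t : ℕ) : ℕ :=
  if t = 0 ∨ t = 2 * tailCount h m 1 + 1 then 0 else slotLevel h m (t / 2)

/-- The surplus of each step of the optimal order. -/
def surplus (h : ℕ) (m : ℕ → ℕ) (t : ℕ) : ℕ :=
  if t % 2 = 0 ∧ t ≠ 0 ∧ t / 2 < levelCount m h then 2 else 0

theorem orderLevel_le (h : ℕ) (m : ℕ → ℕ) (t : ℕ) : orderLevel h m t ≤ h := by
  rw [orderLevel]; split_ifs
  · exact Nat.zero_le _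
  · exact slotLevel_le _ _ _

theorem sum_surplus {h : ℕ} {m : ℕ → ℕ} (hN : 1 ≤ levelCount m h) (k : ℕ) :
    ∑ t ∈ Finset.range (2 * k + 1), surplus h m t + 2 = 2 * min (k + 1) (levelCount m h) := by
  induction k with
  | zero => simp [surplus]; omega
  | succ k ih =>
    rw [show 2 * (k + 1) + 1 = 2 * k + 1 + 1 + 1 by ring, Finset.sum_range_succ,
      Finset.sum_range_succ]
    have h1 : surplus h m (2 * k + 1) = 0 := by
      rw [surplus, if_neg]; omega
    have h2 : surplus h m (2 * k + 1 + 1) = if k + 1 < levelCount m h then 2 else 0 := by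
      rw [surplus]
      congr 1
      simp only [eq_iff_iff]
      omega
    rw [h1, h2]
    split_ifs <;> omega

theorem orderLevel_add_two_le {h : ℕ} {m : ℕ → ℕ} (hh : 1 ≤ h) {t : ℕ} (ht : 1 ≤ t)
    (ht' : t + 1 < 2 * tailCount h m 1) :
    2 * orderLevel h m (t + 1) + 2 ≤ 2 * h + surplus h m t + surplus h m (t + 1) := by
  have h1 : orderLevel h m (t + 1) = listLevel h m ((t + 1) / 2) := by
    rw [orderLevel, if_neg (by omega), slotLevel, if_neg (by omega)]
  have h2 := listLevel_le h m ((t + 1) / 2)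
  rw [h1]
  by_cases h3 : listLevel h m ((t + 1) / 2) = h
  · have h4 := lt_tailCount_listLevel (h := h) (m := m) (q := (t + 1) / 2) (by omega)
    rw [h3, tailCount_self] at h4
    rcases Nat.even_or_odd' t with ⟨k, rfl | rfl⟩
    · have : surplus h m (2 * k) = 2 := by rw [surplus, if_pos]; omega
      omega
    · have : surplus h m (2 * k + 1 + 1) = 2 := by rw [surplus, if_pos]; omega
      omega
  · omega

namespace BiRooted

variable {G : SimpleGraph V} {h : ℕ} {m : ℕ → ℕ}

/-- The vertex in the `q`-th slot of side `s`. -/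
noncomputable def slot (D : BiRooted G h m) (s : Bool) (q : ℕ) : V :=
  D.vtx s (slotLevel h m q) (if q = tailCount h m 1 then 0 else q)

/-- The optimal order: the two sides alternate, starting and ending with the roots. -/
noncomputable def order (D : BiRooted G h m) (t : ℕ) : V :=
  if t = 0 then D.c false else if t = 2 * tailCount h m 1 + 1 then D.c true
  else D.slot (decide (t % 2 = 1)) (t / 2)

theorem lev_order (D : BiRooted G h m) (hm : ∀ i < h, 2 ≤ m i) (t : ℕ) :
    D.lev (D.order t) = orderLevel h m t := by
  rw [order, orderLevel]
  by_cases h1 : t = 0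
  · rw [if_pos h1, if_pos (Or.inl h1), D.lev_c]
  by_cases h2 : t = 2 * tailCount h m 1 + 1
  · rw [if_neg h1, if_pos h2, if_pos (Or.inr h2), D.lev_c]
  · rw [if_neg h1, if_neg h2, if_neg (by tauto), slot, D.lev_vtx hm _ (slotLevel_le _ _ _)]

theorem side_order (D : BiRooted G h m) (hm : ∀ i < h, 2 ≤ m i) (t : ℕ) :
    D.side (D.order t) = decide (t % 2 = 1) := by
  rw [order]
  by_cases h1 : t = 0
  · rw [if_pos h1, D.side_c, h1]; rfl
  by_cases h2 : t = 2 * tailCount h m 1 + 1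
  · rw [if_neg h1, if_pos h2, D.side_c, eq_comm, decide_eq_true_eq]; omega
  · rw [if_neg h1, if_neg h2, slot, D.side_vtx hm _ (slotLevel_le _ _ _)]

theorem card_eq (D : BiRooted G h m) : Fintype.card V = 2 * tailCount h m 1 + 2 := by
  have h1 := D.sum_lev fun _ => 1
  simp only [Finset.sum_const, Finset.card_univ, smul_eq_mul, mul_one] at h1
  rw [h1, ← Finset.mul_sum, Finset.range_eq_Ico]
  change 2 * tailCount h m 0 = _
  rw [← tailCount_succ_add m (Nat.zero_le h)]
  simp [levelCount]; ring

theorem exists_order_eq (D : BiRooted G h m) (hm : ∀ i < h, 2 ≤ m i) (hh : 1 ≤ h) (v : V) :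
    ∃ t < Fintype.card V, D.order t = v := by
  rw [D.card_eq]
  by_cases h0 : D.lev v = 0
  · rw [D.eq_c v h0]
    cases D.side v
    · exact ⟨0, by omega, by simp [order]⟩
    · exact ⟨2 * tailCount h m 1 + 1, by omega, by simp [order]⟩
  have hle := D.lev_le v
  have hpos : ∀ i ≤ h, 0 < levelCount m i := fun i hi => Finset.prod_pos fun j hj => by
    have := hm j (by have := Finset.mem_range.1 hj; omega)
    omega
  obtain ⟨q₀, hq₀⟩ := D.exists_vtx_eq hm v
  set i := D.lev v with hi
  set q := tailCount h m (i + 1) + q₀ % levelCount m i with hq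
  have h1 : q < tailCount h m i := by
    rw [← tailCount_succ_add m hle]
    exact Nat.add_lt_add_left (Nat.mod_lt _ (hpos i hle)) _
  have h2 : listLevel h m q = i := listLevel_eq hle (Nat.le_add_right _ _) h1
  have h3 : q < tailCount h m 1 := h1.trans_le (tailCount_anti h m (by omega))
  have h4 : q ≡ q₀ [MOD levelCount m i] := by
    obtain ⟨k, hk⟩ := levelCount_dvd_tailCount h m i
    rw [hq, hk]
    simp [Nat.ModEq]
  have h5 : ∀ s, D.slot s q = D.vtx s i q₀ := by
    intro s
    rw [slot, slotLevel, if_neg h3.ne, if_neg h3.ne, h2, D.vtx_congr s h4]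
  rcases hs : D.side v with _ | _
  · rw [hs] at hq₀
    rcases Nat.eq_zero_or_pos q with hq0 | hq0
    · refine ⟨2 * tailCount h m 1, by omega, ?_⟩
      have h6 : listLevel h m 0 = h := listLevel_eq le_rfl (by simp [tailCount])
        (by rw [tailCount_self]; exact hpos h le_rfl)
      have h7 := h5 false
      rw [hq0, slot, slotLevel, if_neg (by omega), if_neg (by omega), h6] at h7
      rw [order, if_neg (by omega), if_neg (by omega), ← hq₀, ← h7,
        show 2 * tailCount h m 1 / 2 = tailCount h m 1 by omega, slot, slotLevel, if_pos rfl,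
        if_pos rfl]
      congr 1
      simp
    · refine ⟨2 * q, by omega, ?_⟩
      rw [order, if_neg (by omega), if_neg (by omega), ← hq₀, ← h5,
        show 2 * q / 2 = q by omega]
      congr 1
      simp
  · rw [hs] at hq₀
    refine ⟨2 * q + 1, by omega, ?_⟩
    rw [order, if_neg (by omega), if_neg (by omega), ← hq₀, ← h5,
      show (2 * q + 1) / 2 = q by omega]
    congr 1
    simp [Nat.add_mod]

theorem common_order_le (D : BiRooted G h m) (hm : ∀ i < h, 2 ≤ m i) (hh : 1 ≤ h)
    (hN : ∀ i ≤ h, i ≤ levelCount m i) {i j : ℕ} (hi : 1 ≤ i) (hij : i < j)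
    (hj : j ≤ 2 * tailCount h m 1) (hpar : i % 2 = j % 2) :
    D.common (D.order i) (D.order j) ≤ j / 2 - i / 2 := by
  by_cases hq : j / 2 = tailCount h m 1
  · refine (D.common_le_left _ _).trans ?_
    rw [D.lev_order hm, orderLevel, if_neg (by omega), slotLevel, if_neg (by omega)]
    have h1 := one_le_listLevel (m := m) (q := i / 2) hh (by omega)
    have h2 := lt_tailCount_listLevel (h := h) (m := m) (q := i / 2) (by omega)
    have h3 := tailCount_add_le hN h1 (listLevel_le _ _ _)
    omega
  · rw [order, if_neg (by omega), if_neg (by omega), order, if_neg (by omega), if_neg (by omega),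
      slot, slot, hpar, if_neg (by omega), if_neg hq]
    exact D.common_vtx_le hm hN _ (slotLevel_le _ _ _) (slotLevel_le _ _ _) (by omega)

theorem labelSum_add_dist_order (D : BiRooted G h m) (hG : G.Connected) (hm : ∀ i < h, 2 ≤ m i)
    (hh : 1 ≤ h) (hN : ∀ i ≤ h, i ≤ levelCount m i) {i j : ℕ} (hij : i < j)
    (hj : j ≤ 2 * tailCount h m 1 + 1) :
    labelSum h (orderLevel h m) (surplus h m) i + (2 * h + 2) ≤
      labelSum h (orderLevel h m) (surplus h m) j + G.dist (D.order i) (D.order j) := by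
  have hd := D.lev_add_lev_le hG (D.order i) (D.order j)
  rw [D.lev_order hm, D.lev_order hm, D.side_order hm, D.side_order hm] at hd
  have hl := orderLevel_le h m
  have h1 := le_labelSum_add hl (surplus h m) i (j - i - 1)
  rw [show i + (j - i - 1) + 1 = j by omega] at h1
  by_cases hroot : i = 0 ∨ j = 2 * tailCount h m 1 + 1
  · have h2 : D.common (D.order i) (D.order j) = 0 := by
      rcases hroot with rfl | rfl
      · exact D.common_of_lev_eq_zero_left _ (by rw [D.lev_order hm]; simp [orderLevel])
      · exact D.common_of_lev_eq_zero_right _ (by rw [D.lev_order hm]; simp [orderLevel])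
    rw [h2] at hd
    by_cases hpar : i % 2 = j % 2
    · omega
    · rw [if_neg (by rw [decide_eq_decide]; omega)] at hd
      omega
  · by_cases hpar : i % 2 = j % 2
    · have h2 := D.common_order_le hm hh hN (by omega) hij (by omega) hpar
      have h3 := le_labelSum_add_of_surplus hl (surplus h m) i (j - i - 2)
        (orderLevel_add_two_le hh (by omega) (by omega))
      rw [show i + (j - i - 2) + 2 = j by omega] at h3
      omega
    · have h2 : D.common (D.order i) (D.order j) = 0 := by
        rw [order, if_neg (by omega), if_neg (by omega), order, if_neg (by omega),
          if_neg (by omega), common, Finset.card_eq_zero, Finset.eq_empty_iff_forall_notMem]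
        intro y hy
        rw [Finset.mem_inter] at hy
        obtain ⟨r, -, hr2, rfl⟩ := D.exists_of_mem_anc_vtx hm (slotLevel_le _ _ _) hy.1
        obtain ⟨r', -, hr2', hr'⟩ := D.exists_of_mem_anc_vtx hm (slotLevel_le _ _ _) hy.2
        have h3 := congrArg D.side hr'
        rw [D.side_vtx hm _ (hr2'.trans (slotLevel_le _ _ _)),
          D.side_vtx hm _ (hr2.trans (slotLevel_le _ _ _)), decide_eq_decide] at h3
        omega
      rw [if_neg (by rw [decide_eq_decide]; omega)] at hd
      omega

theorem labelSum_eq_optimum (D : BiRooted G h m) (hm : ∀ i < h, 2 ≤ m i) (hh : 1 ≤ h)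
    (hN : ∀ i ≤ h, i ≤ levelCount m i) :
    (labelSum h (orderLevel h m) (surplus h m) (2 * tailCount h m 1 + 1) : ℤ) = D.optimum := by
  set n := tailCount h m 1 with hn
  have h1 : ∀ T, (labelSum h (orderLevel h m) (surplus h m) T : ℤ) +
      2 * ∑ t ∈ Finset.range (T + 1), (orderLevel h m t : ℤ) =
      T * (2 * h + 1) + ∑ t ∈ Finset.range T, (surplus h m t : ℤ)
        + orderLevel h m 0 + orderLevel h m T := by
    intro T
    induction T with
    | zero => simp [labelSum]; ring
    | succ T ih =>
      have h2 := labelSum_succ (orderLevel_le h m) (surplus h m) T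
      rw [Finset.sum_range_succ (fun t => (orderLevel h m t : ℤ)) (T + 1),
        Finset.sum_range_succ (fun t => (surplus h m t : ℤ)) T]
      push_cast
      zify at h2
      linarith
  have h2 := h1 (2 * n + 1)
  have h3 : ∑ t ∈ Finset.range (2 * n + 1 + 1), (orderLevel h m t : ℤ) =
      ∑ x, (D.lev x : ℤ) := by
    rw [← sum_enumeration (D.exists_order_eq hm hh) fun x => (D.lev x : ℤ), D.card_eq]
    exact Finset.sum_congr rfl fun t _ => by rw [D.lev_order hm]
  have h4 : orderLevel h m 0 = 0 := by simp [orderLevel]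
  have h5 : orderLevel h m (2 * n + 1) = 0 := by simp [orderLevel, hn]
  have h6 := sum_surplus (hh.trans (hN h le_rfl)) n
  have h7 : levelCount m h ≤ n := by
    rw [← tailCount_self]; exact tailCount_anti h m hh
  rw [min_eq_right (by omega)] at h6
  zify at h6
  rw [h3, h4, h5] at h2
  rw [optimum, D.card_eq, D.card_lev_eq le_rfl, ← hn]
  push_cast at h2 ⊢
  linarith

theorem exists_isRadioLabelling (D : BiRooted G h m) (hG : G.Connected) (hm : ∀ i < h, 2 ≤ m i)
    (hh : 1 ≤ h) (hN : ∀ i ≤ h, i ≤ levelCount m i) (hdiam : gdiam G = 2 * h + 1) :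
    ∃ f : V → ℕ, IsRadioLabelling G f ∧ (span f : ℤ) ≤ D.optimum := by
  choose pos hpos hpos' using D.exists_order_eq hm hh
  refine ⟨fun v => labelSum h (orderLevel h m) (surplus h m) (pos v), ?_, ?_⟩
  · have key : ∀ u v, pos u < pos v → (gdiam G : ℤ) + 1 - (G.dist u v : ℤ) ≤
        (labelSum h (orderLevel h m) (surplus h m) (pos v) : ℤ) -
          labelSum h (orderLevel h m) (surplus h m) (pos u) := by
      intro u v huv
      have h1 := hpos v
      rw [D.card_eq] at h1
      have h2 := D.labelSum_add_dist_order hG hm hh hN huv (by omega)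
      rw [hpos', hpos'] at h2
      rw [hdiam]
      push_cast
      zify at h2
      linarith
    intro u v huv
    rcases lt_trichotomy (pos u) (pos v) with h1 | h1 | h1
    · rw [abs_sub_comm]
      exact (key u v h1).trans (le_abs_self _)
    · exact absurd (by rw [← hpos' u, ← hpos' v, h1]) huv
    · rw [dist_comm]
      exact (key v u h1).trans (le_abs_self _)
  · rw [← D.labelSum_eq_optimum hm hh hN]
    have : ∀ v, labelSum h (orderLevel h m) (surplus h m) (pos v) ≤
        labelSum h (orderLevel h m) (surplus h m) (2 * tailCount h m 1 + 1) := by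
      intro v
      have h1 := hpos v
      rw [D.card_eq] at h1
      exact Finset.sum_le_sum_of_subset (Finset.range_subset_range.2 (by omega))
    have hspan : span (fun v => labelSum h (orderLevel h m) (surplus h m) (pos v)) ≤
        labelSum h (orderLevel h m) (surplus h m) (2 * tailCount h m 1 + 1) :=
      Finset.sup_le fun p _ => (Nat.sub_le _ _).trans (this p.1)
    exact_mod_cast hspan

theorem radioNumber_eq_optimum (D : BiRooted G h m) (hG : G.Connected) (hm : ∀ i < h, 2 ≤ m i)
    (hh : 1 ≤ h) (hm0 : m 0 = 2) (hN : ∀ i ≤ h, i ≤ levelCount m i) :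
    (radioNumber G : ℤ) = D.optimum := by
  have hdiam := D.gdiam_eq hm hG
  obtain ⟨f, hf, hfs⟩ := D.exists_isRadioLabelling hG hm hh hN hdiam
  apply le_antisymm
  · have : radioNumber G ≤ span f := Nat.sInf_le ⟨f, hf, rfl⟩
    exact (Int.ofNat_le.2 this).trans hfs
  · obtain ⟨g, hg, hgs⟩ : radioNumber G ∈ {s | ∃ f : V → ℕ, IsRadioLabelling G f ∧ span f = s} :=
      Nat.sInf_mem ⟨_, f, hf, rfl⟩
    rw [← hgs]
    exact D.optimum_le_span hG hh hm0 hdiam hg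

theorem optimum_eq (D : BiRooted G h m) (hh : 1 ≤ h) (hm0 : m 0 = 2) :
    D.optimum = ((∑ i ∈ Finset.Icc 1 (h - 1), (4 * (h - i) - 2) * ∏ j ∈ Finset.Icc 1 i, (m j - 1)
        + 2 * (∏ i ∈ Finset.Icc 1 (h - 1), (m i - 1)) + 6 * h - 3 : ℕ) : ℤ) := by
  have hprod : ∀ i, ∏ j ∈ Finset.Icc 1 i, (m j - 1) = levelCount m (i + 1) := by
    intro i
    induction i with
    | zero => simp [levelCount, hm0]
    | succ i ih => rw [Finset.prod_Icc_succ_top (by omega), ih, levelCount_succ _ (i + 1)]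
  obtain ⟨k, rfl⟩ : ∃ k, h = k + 1 := ⟨h - 1, by omega⟩
  have h1 := D.sum_lev fun _ => (1 : ℤ)
  have h2 := D.sum_lev fun i => (i : ℤ)
  simp only [Finset.sum_const, Finset.card_univ, nsmul_eq_mul, mul_one] at h1 h2
  rw [optimum, h1, h2, D.card_lev_eq le_rfl]
  simp only [hprod, Nat.add_sub_cancel]
  have hsum : ∀ f : ℕ → ℤ,
      ∑ x ∈ Finset.range (k + 2), f x = f 0 + f 1 + ∑ i ∈ Finset.Icc 1 k, f (i + 1) := by
    intro f
    rw [Finset.sum_range_succ', Finset.sum_range_succ', Finset.range_eq_Ico,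
      Finset.sum_Ico_add' (fun i => f (i + 1)) 0 k 1]
    simp only [zero_add, ← Finset.Ico_add_one_right_eq_Icc]
    ring
  have h3 : ((∑ i ∈ Finset.Icc 1 k, (4 * (k + 1 - i) - 2) * levelCount m (i + 1) : ℕ) : ℤ) =
      ∑ i ∈ Finset.Icc 1 k, ((2 * ((k : ℤ) + 1) + 1) * (2 * (levelCount m (i + 1) : ℤ)) -
        2 * (2 * (levelCount m (i + 1) : ℤ) * ((i : ℤ) + 1))) := by
    rw [Nat.cast_sum]
    refine Finset.sum_congr rfl fun i hi => ?_
    obtain ⟨-, hik⟩ := Finset.mem_Icc.1 hi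
    obtain ⟨d, rfl⟩ := Nat.exists_eq_add_of_le hik
    rw [show 4 * (i + d + 1 - i) - 2 = 4 * d + 2 by omega]
    push_cast
    ring
  simp only [Finset.sum_sub_distrib, mul_assoc, ← Finset.mul_sum] at h3
  rw [Nat.cast_sub (by omega), hsum, hsum]
  have h4 : levelCount m 0 = 1 := rfl
  have h5 : levelCount m 1 = 1 := by simp [levelCount, hm0]
  rw [h4, h5]
  rw [Nat.cast_add _ (6 * (k + 1)), Nat.cast_add _ (2 * levelCount m (k + 1)), h3]
  push_cast
  simp only [mul_assoc, ← Finset.mul_sum]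
  ring

end BiRooted

/-- **Theorem (level-wise regular trees, two centers).** For `h ≥ 1` and `m_i ≥ 3`
(`1 ≤ i ≤ h-1`), the radio number of `T^2_{2, m_1, …, m_{h-1}}`. -/
theorem stmt6 {V : Type*} [Fintype V] [DecidableEq V] (G : SimpleGraph V)
    (h : ℕ) (m : ℕ → ℕ) (hh : 1 ≤ h) (hm0 : m 0 = 2)
    (hm : ∀ i : ℕ, 1 ≤ i → i ≤ h - 1 → 3 ≤ m i)
    (hG : IsLevelwiseRegular G 2 h m) :
    radioNumber G =
      (∑ i ∈ Finset.Icc 1 (h-1), (4 * (h - i) - 2) * ∏ j ∈ Finset.Icc 1 i, (m j - 1))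
        + 2 * (∏ i ∈ Finset.Icc 1 (h-1), (m i - 1)) + 6 * h - 3 := by
  obtain ⟨D⟩ := nonempty_biRooted hG
  have hm2 : ∀ i < h, 2 ≤ m i := by
    intro i hi
    rcases Nat.eq_zero_or_pos i with rfl | h0
    · exact hm0.ge
    · exact (hm i h0 (by omega)).trans' (by omega)
  have h1 := D.radioNumber_eq_optimum hG.1.connected hm2 hh hm0
    fun i hi => le_levelCount hm0 hm hi
  rw [D.optimum_eq hh hm0] at h1
  exact_mod_cast h1

end RadioPaper
end

section
/- Let h ≥ 2 be an integer and let T_h be the complete binary tree of height h. Then rn(T_h) = 13·2^{h-1} - 4h - 5. -/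
open SimpleGraph Finset

open scoped Classical

namespace RadioPaper

variable {V : Type*} [Fintype V] [DecidableEq V]

/-- Coordinates on a complete binary tree of height `h` in `G`: `p a i` is the vertex at level `i`
reached from the root by following the bits of `a`, lowest bit first. -/
structure BinaryCoords {V : Type*} (G : SimpleGraph V) (h : ℕ) (p : ℕ → ℕ → V) : Prop where
  connected : G.Connected
  root_eq : ∀ a b, p a 0 = p b 0
  adj_succ : ∀ a i, i < h → G.Adj (p a i) (p a (i + 1))
  inj : ∀ a b i j, i ≤ h → j ≤ h → p a i = p b j → i = j ∧ a % 2 ^ i = b % 2 ^ i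
  congr : ∀ a b i, a % 2 ^ i = b % 2 ^ i → p a i = p b i
  of_adj : ∀ a i y, i ≤ h → G.Adj (p a i) y → (∃ j, i = j + 1 ∧ y = p a j) ∨
    (i < h ∧ ∃ b, b % 2 ^ i = a % 2 ^ i ∧ y = p b (i + 1))

theorem parent_unique {V : Type*} {G : SimpleGraph V} (hT : G.IsTree) {r x y z : V}
    (hy : G.Adj x y) (hz : G.Adj x z) (hdy : G.dist r x = G.dist r y + 1)
    (hdz : G.dist r x = G.dist r z + 1) : y = z := by
  obtain ⟨w, hw⟩ := hT.connected.exists_walk_length_eq_dist r y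
  obtain ⟨w', hw'⟩ := hT.connected.exists_walk_length_eq_dist r z
  have hp : (w.concat hy.symm).IsPath :=
    SimpleGraph.Walk.isPath_of_length_eq_dist _ (by rw [SimpleGraph.Walk.length_concat]; omega)
  have hp' : (w'.concat hz.symm).IsPath :=
    SimpleGraph.Walk.isPath_of_length_eq_dist _ (by rw [SimpleGraph.Walk.length_concat]; omega)
  exact (SimpleGraph.Walk.concat_inj ((hT.existsUnique_path r x).unique hp hp')).1

theorem exists_children {V : Type*} [Finite V] {G : SimpleGraph V} (hT : G.IsTree) {r x : V}
    (hx : (G.neighborSet x).ncard = if G.dist r x = 0 then 2 else 3) :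
    ∃ c : Bool → V, c false ≠ c true ∧
      ∀ y, G.Adj x y ∧ G.dist r y = G.dist r x + 1 ↔ ∃ b, y = c b := by
  suffices {y | G.Adj x y ∧ G.dist r y = G.dist r x + 1}.ncard = 2 by
    obtain ⟨u, v, huv, hS⟩ := Set.ncard_eq_two.1 this
    refine ⟨fun b => if b then v else u, by simpa using huv, fun y => ?_⟩
    have := Set.ext_iff.1 hS y
    simp only [Set.mem_ofPred_eq, Set.mem_insert_iff, Set.mem_singleton_iff] at this
    simp [this]
  by_cases h0 : G.dist r x = 0
  · rw [if_pos h0] at hx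
    rw [← hx]
    congr 1
    ext y
    simp only [Set.mem_ofPred_eq, SimpleGraph.mem_neighborSet, and_iff_left_iff_imp]
    intro hy
    have := hT.dist_eq_dist_add_one_of_adj r hy
    omega
  · rw [if_neg h0] at hx
    obtain ⟨y, hy, hdy⟩ : ∃ y, G.Adj x y ∧ G.dist r x = G.dist r y + 1 := by
      obtain ⟨w, hw⟩ := hT.connected.exists_walk_length_eq_dist x r
      rw [SimpleGraph.dist_comm] at hw
      cases w with
      | nil => exact absurd hw.symm h0
      | @cons _ y _ hxy w =>
        refine ⟨y, hxy, ?_⟩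
        have := SimpleGraph.dist_le w
        rw [SimpleGraph.dist_comm] at this
        have := hT.dist_eq_dist_add_one_of_adj r hxy
        rw [SimpleGraph.Walk.length_cons] at hw
        omega
    have hins : G.neighborSet x = insert y {y | G.Adj x y ∧ G.dist r y = G.dist r x + 1} := by
      ext z
      simp only [Set.mem_ofPred_eq, SimpleGraph.mem_neighborSet, Set.mem_insert_iff]
      constructor
      · intro hz
        rcases hT.dist_eq_dist_add_one_of_adj r hz with h1 | h1
        · exact .inl (parent_unique hT hz hy h1 hdy)
        · exact .inr ⟨hz, h1⟩
      · rintro (rfl | hz)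
        exacts [hy, hz.1]
    rw [hins, Set.ncard_insert_of_notMem (by simp only [Set.mem_ofPred_eq]; omega)] at hx
    omega

theorem mod_two_pow_succ_eq_iff (a b i : ℕ) :
    a % 2 ^ (i + 1) = b % 2 ^ (i + 1) ↔ a % 2 ^ i = b % 2 ^ i ∧ a.testBit i = b.testBit i := by
  rw [Nat.mod_pow_succ, Nat.mod_pow_succ (x := b), Nat.testBit_eq_decide_div_mod_eq,
    Nat.testBit_eq_decide_div_mod_eq]
  have ha := Nat.mod_lt a (Nat.two_pow_pos i)
  have hb := Nat.mod_lt b (Nat.two_pow_pos i)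
  rcases Nat.mod_two_eq_zero_or_one (a / 2 ^ i) with h1 | h1 <;>
  rcases Nat.mod_two_eq_zero_or_one (b / 2 ^ i) with h2 | h2 <;> simp [h1, h2] <;> omega

theorem exists_mod_two_pow_testBit (a i : ℕ) (b : Bool) :
    ∃ c, c % 2 ^ i = a % 2 ^ i ∧ c.testBit i = b := by
  have ha := Nat.mod_lt a (Nat.two_pow_pos i)
  cases b
  · exact ⟨a % 2 ^ i, by simp, by simp⟩
  · refine ⟨a % 2 ^ i + 2 ^ i, by simp, ?_⟩
    rw [Nat.testBit_eq_decide_div_mod_eq, Nat.add_div_right _ (Nat.two_pow_pos i),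
      Nat.div_eq_of_lt ha]
    simp

theorem exists_binaryCoords {V : Type*} [Finite V] {G : SimpleGraph V} (hT : G.IsTree) {r : V}
    {h : ℕ} (hle : ∀ x, G.dist r x ≤ h)
    (hdeg : ∀ x, G.dist r x < h → (G.neighborSet x).ncard = if G.dist r x = 0 then 2 else 3) :
    ∃ p, BinaryCoords G h p := by
  have H : ∀ x, ∃ c : Bool → V, G.dist r x < h → c false ≠ c true ∧
      ∀ y, G.Adj x y ∧ G.dist r y = G.dist r x + 1 ↔ ∃ b, y = c b := by
    intro x
    by_cases hx : G.dist r x < h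
    · obtain ⟨c, hc⟩ := exists_children hT (hdeg x hx)
      exact ⟨c, fun _ => hc⟩
    · exact ⟨fun _ => x, fun h => absurd h hx⟩
  choose c hne hc using H
  have hcb : ∀ x b, G.dist r x < h → G.Adj x (c x b) ∧ G.dist r (c x b) = G.dist r x + 1 :=
    fun x b hx => (hc x hx _).2 ⟨b, rfl⟩
  let p : ℕ → ℕ → V := fun a i => Nat.rec r (fun i x => c x (a.testBit i)) i
  have hp0 : ∀ a, p a 0 = r := fun _ => rfl
  have hps : ∀ a i, p a (i + 1) = c (p a i) (a.testBit i) := fun _ _ => rfl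
  have hlev : ∀ a i, i ≤ h → G.dist r (p a i) = i := by
    intro a i
    induction i with
    | zero => intro _; simp [hp0]
    | succ i ih =>
      intro hi
      have := ih (by omega)
      rw [hps, (hcb _ _ (by omega)).2, this]
  have hadj : ∀ a i, i < h → G.Adj (p a i) (p a (i + 1)) := fun a i hi => by
    rw [hps]
    exact (hcb _ _ (by rw [hlev a i hi.le]; exact hi)).1
  have hcongr : ∀ a b i, a % 2 ^ i = b % 2 ^ i → p a i = p b i := by
    intro a b i
    induction i with
    | zero => intro _; rfl
    | succ i ih =>
      intro hab
      rw [mod_two_pow_succ_eq_iff] at hab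
      rw [hps, hps, ih hab.1, hab.2]
  refine ⟨p, hT.connected, fun _ _ => rfl, hadj, ?_, hcongr, ?_⟩
  · intro a b i j hi hj hab
    have hij : i = j := by rw [← hlev a i hi, hab, hlev b j hj]
    subst hij
    refine ⟨rfl, ?_⟩
    induction i with
    | zero => simp [Nat.mod_one]
    | succ i ih =>
      have hpar : p a i = p b i :=
        parent_unique hT (r := r) (hadj a i hi).symm (hab ▸ (hadj b i hi).symm)
          (by rw [hlev _ _ hi, hlev _ _ (by omega)]) (by rw [hlev _ _ hi, hlev _ _ (by omega)])
      rw [mod_two_pow_succ_eq_iff]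
      refine ⟨ih (by omega) (by omega) hpar, ?_⟩
      have hn := hne (p b i) (by rw [hlev b i (by omega)]; omega)
      rw [hps, hps, hpar] at hab
      exact Bool.injective_iff.2 hn hab
  · intro a i y hi hy
    have hl := hlev a i hi
    rcases hT.dist_eq_dist_add_one_of_adj r hy with h1 | h1
    · left
      obtain ⟨j, rfl⟩ : ∃ j, i = j + 1 := ⟨i - 1, by omega⟩
      refine ⟨j, rfl, parent_unique hT hy (hadj a j hi).symm h1 ?_⟩
      rw [hl, hlev a j (by omega)]
    · right
      have hih : i < h := by have := hle y; omega
      refine ⟨hih, ?_⟩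
      obtain ⟨b, rfl⟩ := (hc _ (by omega) y).1 ⟨hy, h1⟩
      obtain ⟨a', ha', hb⟩ := exists_mod_two_pow_testBit a i b
      exact ⟨a', ha', by rw [hps, hb, hcongr a' a i ha']⟩

namespace BinaryCoords

variable {V : Type*} {G : SimpleGraph V} {h : ℕ} {p : ℕ → ℕ → V}

theorem exists_eq (C : BinaryCoords G h p) (x : V) : ∃ a i, i ≤ h ∧ x = p a i := by
  obtain ⟨w⟩ := C.connected x (p 0 0)
  generalize hy : p 0 0 = y at w
  induction w with
  | nil => exact ⟨0, 0, h.zero_le, hy.symm⟩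
  | cons hadj _ ih =>
    obtain ⟨a, i, hi, rfl⟩ := ih hy
    rcases C.of_adj a i _ hi hadj.symm with ⟨j, rfl, rfl⟩ | ⟨hi', b, -, rfl⟩
    · exact ⟨a, j, by omega, rfl⟩
    · exact ⟨b, i + 1, hi', rfl⟩

theorem exists_le_walk_length (C : BinaryCoords G h p) {x y : V} (w : G.Walk x y) :
    ∀ a b i j, i ≤ h → j ≤ h → x = p a i → y = p b j →
      ∃ k, k ≤ i ∧ k ≤ j ∧ a % 2 ^ k = b % 2 ^ k ∧ i + j ≤ w.length + 2 * k := by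
  induction w with
  | nil =>
    rintro a b i j hi hj rfl hy
    obtain ⟨rfl, hab⟩ := C.inj a b i j hi hj hy
    exact ⟨i, le_rfl, le_rfl, hab, by omega⟩
  | cons hadj w ih =>
    rintro a b i j hi hj rfl rfl
    rw [SimpleGraph.Walk.length_cons]
    rcases C.of_adj a i _ hi hadj with ⟨i', rfl, rfl⟩ | ⟨hi', a', ha', rfl⟩
    · obtain ⟨k, h1, h2, h3, h4⟩ := ih a b i' j (by omega) hj rfl rfl
      exact ⟨k, by omega, h2, h3, by omega⟩
    · obtain ⟨k, h1, h2, h3, h4⟩ := ih a' b (i + 1) j hi' hj rfl rfl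
      have hmod : ∀ l, l ≤ i → l ≤ k → a % 2 ^ l = b % 2 ^ l := fun l hl hk => by
        have e1 : a' ≡ a [MOD 2 ^ l] := Nat.ModEq.of_dvd (pow_dvd_pow 2 hl) ha'
        have e2 : a' ≡ b [MOD 2 ^ l] := Nat.ModEq.of_dvd (pow_dvd_pow 2 hk) h3
        exact e1.symm.trans e2
      rcases Nat.lt_or_ge i k with hk | hk
      · exact ⟨i, le_rfl, by omega, hmod i le_rfl hk.le, by omega⟩
      · exact ⟨k, hk, h2, hmod k hk le_rfl, by omega⟩

theorem exists_le_dist (C : BinaryCoords G h p) (a b : ℕ) {i j : ℕ} (hi : i ≤ h) (hj : j ≤ h) :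
    ∃ k, k ≤ i ∧ k ≤ j ∧ a % 2 ^ k = b % 2 ^ k ∧ i + j ≤ G.dist (p a i) (p b j) + 2 * k := by
  obtain ⟨w, hw⟩ := C.connected.exists_walk_length_eq_dist (p a i) (p b j)
  rw [← hw]
  exact C.exists_le_walk_length w a b i j hi hj rfl rfl

theorem dist_add_le (C : BinaryCoords G h p) (a i k : ℕ) (hk : i + k ≤ h) :
    G.dist (p a i) (p a (i + k)) ≤ k := by
  induction k with
  | zero => simp
  | succ k ih =>
    have h1 := ih (by omega)
    have h2 := SimpleGraph.dist_eq_one_iff_adj.2 (C.adj_succ a (i + k) (by omega))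
    have h3 := C.connected.dist_triangle (u := p a i) (v := p a (i + k)) (w := p a (i + k + 1))
    rw [← add_assoc]
    omega

theorem dist_le_of_mod_eq (C : BinaryCoords G h p) {a b i j k : ℕ} (hki : k ≤ i) (hkj : k ≤ j)
    (hi : i ≤ h) (hj : j ≤ h) (hab : a % 2 ^ k = b % 2 ^ k) :
    G.dist (p a i) (p b j) + 2 * k ≤ i + j := by
  have h1 := C.dist_add_le a k (i - k) (by omega)
  have h2 := C.dist_add_le b k (j - k) (by omega)
  rw [Nat.add_sub_cancel' hki, SimpleGraph.dist_comm] at h1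
  rw [Nat.add_sub_cancel' hkj, ← C.congr a b k hab] at h2
  have h3 := C.connected.dist_triangle (u := p a i) (v := p a k) (w := p b j)
  omega

theorem dist_le_add (C : BinaryCoords G h p) (a b : ℕ) {i j : ℕ} (hi : i ≤ h) (hj : j ≤ h) :
    G.dist (p a i) (p b j) ≤ i + j := by
  simpa using C.dist_le_of_mod_eq (k := 0) i.zero_le j.zero_le hi hj (by simp [Nat.mod_one])

theorem gdiam_eq [Fintype V] [DecidableEq V] (C : BinaryCoords G h p) : gdiam G = 2 * h := by
  refine le_antisymm (Finset.sup_le fun xy _ => ?_) ?_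
  · obtain ⟨a, i, hi, hx⟩ := C.exists_eq xy.1
    obtain ⟨b, j, hj, hy⟩ := C.exists_eq xy.2
    rw [hx, hy]
    exact (C.dist_le_add a b hi hj).trans (by omega)
  · obtain ⟨k, -, -, hk, hd⟩ := C.exists_le_dist 0 1 (le_refl h) (le_refl h)
    have hk0 : k = 0 := by
      by_contra hk0
      rw [Nat.zero_mod, Nat.mod_eq_of_lt (Nat.one_lt_two_pow hk0)] at hk
      omega
    have := Finset.le_sup (f := fun xy : V × V => G.dist xy.1 xy.2)
      (Finset.mem_univ (p 0 h, p 1 h))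
    unfold gdiam
    dsimp only at this
    omega

end BinaryCoords

/-- The level of the `q`-th vertex in the breadth-first order in which the root is moved from
position `1` to position `2 ^ (h + 1)`, after all other vertices. -/
def heapLevel (h q : ℕ) : ℕ := if q = 2 ^ (h + 1) then 0 else Nat.log 2 q

theorem heapLevel_last (h : ℕ) : heapLevel h (2 ^ (h + 1)) = 0 := if_pos rfl

theorem heapLevel_of_lt {h q : ℕ} (hq : q < 2 ^ (h + 1)) : heapLevel h q = Nat.log 2 q :=
  if_neg hq.ne

theorem heapLevel_le {h q : ℕ} (hq : q ≤ 2 ^ (h + 1)) : heapLevel h q ≤ h := by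
  rcases hq.eq_or_lt with rfl | hq
  · simp [heapLevel_last]
  · rw [heapLevel_of_lt hq]
    exact Nat.lt_succ_iff.1 (Nat.log_lt_of_lt_pow' (by omega) hq)

theorem heapLevel_pos {h q : ℕ} (h2 : 2 ≤ q) (hq : q < 2 ^ (h + 1)) : 0 < heapLevel h q := by
  rw [heapLevel_of_lt hq]
  exact Nat.log_pos (by omega) h2

theorem heapLevel_two_pow_add {h i e : ℕ} (hi : i ≤ h) (he : e < 2 ^ i) :
    heapLevel h (2 ^ i + e) = i := by
  have h1 : 2 ^ i + e < 2 ^ (i + 1) := by rw [pow_succ]; omega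
  rw [heapLevel_of_lt (h1.trans_le (Nat.pow_le_pow_right (by omega) (by omega)))]
  exact Nat.log_eq_of_pow_le_of_lt_pow (by omega) h1

theorem exists_eq_two_pow_add {h q : ℕ} (h2 : 2 ≤ q) (hq : q < 2 ^ (h + 1)) :
    ∃ i e, 0 < i ∧ i ≤ h ∧ e < 2 ^ i ∧ q = 2 ^ i + e := by
  have h1 := Nat.pow_log_le_self 2 (x := q) (by omega)
  have h3 := Nat.lt_pow_succ_log_self (b := 2) (by omega) q
  rw [pow_succ] at h3
  have h4 := heapLevel_pos h2 hq
  have h5 := heapLevel_le hq.le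
  rw [heapLevel_of_lt hq] at h4 h5
  exact ⟨Nat.log 2 q, q - 2 ^ Nat.log 2 q, h4, h5, by omega, by omega⟩

theorem BinaryCoords.bijOn {V : Type*} {G : SimpleGraph V} {h : ℕ} {p : ℕ → ℕ → V}
    (C : BinaryCoords G h p) :
    Set.BijOn (fun q => p q (heapLevel h q)) (Set.Icc 2 (2 ^ (h + 1))) Set.univ := by
  refine ⟨fun _ _ => Set.mem_univ _, ?_, ?_⟩
  · intro q hq q' hq' heq
    obtain ⟨hl, hm⟩ := C.inj q q' _ _ (heapLevel_le hq.2) (heapLevel_le hq'.2) heq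
    rcases hq.2.eq_or_lt with h1 | h1 <;> rcases hq'.2.eq_or_lt with h2 | h2
    · omega
    · have := heapLevel_pos hq'.1 h2
      rw [h1, heapLevel_last] at hl
      omega
    · have := heapLevel_pos hq.1 h1
      rw [h2, heapLevel_last] at hl
      omega
    · obtain ⟨i, e, -, hi, he, rfl⟩ := exists_eq_two_pow_add hq.1 h1
      obtain ⟨j, e', -, hj, he', rfl⟩ := exists_eq_two_pow_add hq'.1 h2
      rw [heapLevel_two_pow_add hi he, heapLevel_two_pow_add hj he'] at hl
      subst hl
      rw [heapLevel_two_pow_add hi he, Nat.add_mod_left, Nat.add_mod_left, Nat.mod_eq_of_lt he,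
        Nat.mod_eq_of_lt he'] at hm
      rw [hm]
  · rintro x -
    obtain ⟨a, i, hi, rfl⟩ := C.exists_eq x
    rcases i.eq_zero_or_pos with rfl | h0
    · refine ⟨2 ^ (h + 1), ⟨?_, le_rfl⟩, ?_⟩
      · rw [pow_succ]
        have := Nat.two_pow_pos h
        omega
      · dsimp only
        rw [heapLevel_last]
        exact C.root_eq _ _
    · have he : a % 2 ^ i < 2 ^ i := Nat.mod_lt _ (Nat.two_pow_pos i)
      have h1 : 2 ^ 1 ≤ 2 ^ i := Nat.pow_le_pow_right (by omega) h0
      have h2 : 2 ^ (i + 1) ≤ 2 ^ (h + 1) := Nat.pow_le_pow_right (by omega) (by omega)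
      rw [pow_succ] at h2
      refine ⟨2 ^ i + a % 2 ^ i, ⟨by omega, by omega⟩, ?_⟩
      dsimp only
      rw [heapLevel_two_pow_add hi he]
      exact C.congr _ _ _ (by simp)

theorem sum_heapLevel (h : ℕ) (g : ℕ → ℤ) :
    ∑ q ∈ Finset.Icc 2 (2 ^ (h + 1)), g (heapLevel h q) =
      ∑ i ∈ Finset.range (h + 1), 2 ^ i * g i := by
  have key : ∀ k, k ≤ h → ∑ q ∈ Finset.Ico 2 (2 ^ (k + 1)), g (heapLevel h q) + g 0 =
      ∑ i ∈ Finset.range (k + 1), 2 ^ i * g i := by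
    intro k
    induction k with
    | zero => simp
    | succ k ih =>
      intro hk
      have h1 : 2 ≤ 2 ^ (k + 1) := Nat.le_self_pow (by omega) 2
      have h2 : 2 ^ (k + 1) ≤ 2 ^ (k + 1 + 1) := Nat.pow_le_pow_right (by omega) (by omega)
      have h3 : 2 ^ (k + 1 + 1) - 2 ^ (k + 1) = 2 ^ (k + 1) := by rw [pow_succ 2 (k + 1)]; omega
      have h4 : ∑ e ∈ Finset.range (2 ^ (k + 1)), g (heapLevel h (2 ^ (k + 1) + e)) =
          2 ^ (k + 1) * g (k + 1) := by
        rw [Finset.sum_congr rfl fun e he => by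
          rw [heapLevel_two_pow_add hk (Finset.mem_range.1 he)]]
        simp
      rw [Finset.sum_range_succ, ← ih (by omega), ← Finset.sum_Ico_consecutive _ h1 h2,
        Finset.sum_Ico_eq_sum_range _ (2 ^ (k + 1)), h3, h4]
      ring
  have h1 : 2 ≤ 2 ^ (h + 1) := Nat.le_self_pow (by omega) 2
  rw [← key h le_rfl, ← Finset.Ico_insert_right h1, Finset.sum_insert (by simp), heapLevel_last,
    add_comm]

theorem sum_two_pow_mul_self (h : ℕ) :
    ∑ i ∈ Finset.range (h + 1), (2 ^ i * i : ℤ) = (h - 1) * 2 ^ (h + 1) + 2 := by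
  induction h with
  | zero => simp
  | succ h ih =>
    rw [Finset.sum_range_succ, ih]
    push_cast
    ring

theorem sum_two_pow (h : ℕ) : ∑ i ∈ Finset.range (h + 1), (2 ^ i : ℤ) = 2 ^ (h + 1) - 1 := by
  linarith [geom_sum_mul (2 : ℤ) (h + 1)]

/-- Slack accounting for a labelling along an ordering of a tree with levels `l`: `D` plays the
role of `diam + 1`, while `a` and `b` indicate the leaves and the root. -/
theorem le_two_mul_sub_of_slack {D A : ℤ} {F l a b : ℕ → ℤ} {M : ℕ}
    (hs : ∀ t ≤ M, D ≤ F (t + 1) - F t + l t + l (t + 1))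
    (hs2 : ∀ t < M, 2 * D + a (t + 1) - b t - b (t + 2) ≤
      F (t + 2) - F t + l t + 2 * l (t + 1) + l (t + 2))
    (hend : ∀ t, 2 + a t ≤ 2 * l t + 2 * b t) (hb : ∀ t, 0 ≤ b t)
    (ha : ∑ t ∈ Finset.range (M + 2), a t = A) (hb1 : ∑ t ∈ Finset.range (M + 2), b t = 1) :
    2 * ((M + 1) * D) - 4 * ∑ t ∈ Finset.range (M + 2), l t + A + 1 ≤
      2 * (F (M + 1) - F 0) := by
  have key : ∀ m ≤ M, 2 * ((m + 1) * D) - 4 * ∑ t ∈ Finset.range (m + 2), l t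
      + 2 * l 0 + 2 * l (m + 1) + (∑ t ∈ Finset.range (m + 2), a t - a 0 - a (m + 1))
      - (2 * ∑ t ∈ Finset.range (m + 2), b t - b 0 - b 1 - b m - b (m + 1))
      + (F 1 - F 0 + l 0 + l 1 - D) + (F (m + 1) - F m + l m + l (m + 1) - D)
      ≤ 2 * (F (m + 1) - F 0) := by
    intro m
    induction m with
    | zero =>
      intro _
      simp only [Finset.sum_range_succ, Finset.sum_range_zero, Nat.cast_zero, zero_add]
      linarith
    | succ m ih =>
      intro hm
      have h1 := ih (by omega)
      have h2 := hs2 m (by omega)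
      rw [Finset.sum_range_succ _ (m + 2), Finset.sum_range_succ _ (m + 2),
        Finset.sum_range_succ _ (m + 2)]
      push_cast
      simp only [show m + 1 + 1 = m + 2 from rfl] at *
      linarith
  have h1 := key M le_rfl
  have h2 := hs 0 M.zero_le
  have h3 := hs M le_rfl
  have h4 : b 0 + b (M + 1) ≤ 1 := by
    rw [← hb1, Finset.sum_range_succ, Finset.sum_range_succ']
    have := Finset.sum_nonneg (s := Finset.range M) fun t _ => hb (t + 1)
    linarith
  have := hend 0
  have := hend (M + 1)
  have := hb 1
  have := hb M
  simp only [zero_add] at h2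
  linarith

theorem exists_sorted_enumeration {V : Type*} [Fintype V] (f : V → ℕ) :
    ∃ e : Fin (Fintype.card V) ≃ V, Monotone (f ∘ e) := by
  let e := (Fintype.equivFin V).symm
  exact ⟨(Tuple.sort (f ∘ e)).trans e, Tuple.monotone_sort (f ∘ e)⟩

theorem BinaryCoords.le_two_mul_span {V : Type*} [Fintype V] [DecidableEq V]
    {G : SimpleGraph V} {h : ℕ} {p : ℕ → ℕ → V} (C : BinaryCoords G h p) (hh : 2 ≤ h)
    {f : V → ℕ} (hf : IsRadioLabelling G f) :
    13 * 2 ^ h - 8 * h - 11 ≤ 2 * (span f : ℤ) := by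
  have hbij := C.bijOn
  choose! code hcode hpc using fun x => hbij.surjOn (Set.mem_univ x)
  set L : V → ℕ := fun x => heapLevel h (code x) with hL
  have hLh : ∀ x, L x ≤ h := fun x => heapLevel_le (hcode x).2
  have hx : ∀ x, p (code x) (L x) = x := hpc
  have hsum : ∀ g : ℕ → ℤ, ∑ x, g (L x) = ∑ i ∈ Finset.range (h + 1), 2 ^ i * g i := by
    intro g
    rw [← sum_heapLevel]
    refine Finset.sum_nbij' code (fun q => p q (heapLevel h q)) (fun x _ => ?_)
      (fun _ _ => Finset.mem_univ _) (fun x _ => hx x) (fun q hq => ?_) (fun _ _ => rfl)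
    · exact Finset.mem_Icc.2 (hcode x)
    · exact hbij.injOn (hcode _) (Finset.mem_Icc.1 hq) (hpc _)
  have hcard : (Fintype.card V : ℤ) = 2 ^ (h + 1) - 1 := by
    have := hsum fun _ => 1
    simpa [sum_two_pow] using this
  have hdist : ∀ x y, G.dist x y ≤ L x + L y := fun x y => by
    conv_lhs => rw [← hx x, ← hx y]
    exact C.dist_le_add _ _ (hLh x) (hLh y)
  have hbranch : ∀ x y, 0 < L x → 0 < L y → code x % 2 = code y % 2 →
      G.dist x y + 2 ≤ L x + L y := fun x y h1 h2 h3 => by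
    conv_lhs => rw [← hx x, ← hx y]
    exact C.dist_le_of_mod_eq (k := 1) h1 h2 (hLh x) (hLh y) (by simpa using h3)
  obtain ⟨e, he⟩ := exists_sorted_enumeration f
  obtain ⟨M, hM⟩ : ∃ M, Fintype.card V = M + 2 := by
    refine ⟨Fintype.card V - 2, ?_⟩
    have : (2 : ℤ) ^ 2 ≤ 2 ^ (h + 1) := pow_le_pow_right₀ (by norm_num) (by omega)
    omega
  have : NeZero (Fintype.card V) := ⟨by omega⟩
  let x : ℕ → V := fun t => e (Fin.ofNat _ t)
  have hxlt : ∀ s t, s < t → t ≤ M + 1 →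
      (2 * h + 1 : ℤ) ≤ f (x t) - f (x s) + G.dist (x s) (x t) := by
    intro s t hst ht
    have h1 : Fin.ofNat (Fintype.card V) s < Fin.ofNat (Fintype.card V) t := by
      rw [Fin.lt_def, Fin.val_ofNat, Fin.val_ofNat, Nat.mod_eq_of_lt (by omega),
        Nat.mod_eq_of_lt (by omega)]
      exact hst
    have h2 : f (x s) ≤ f (x t) := he h1.le
    have h3 := hf (x s) (x t) (e.injective.ne h1.ne)
    rw [C.gdiam_eq, abs_sub_comm, abs_of_nonneg (by omega)] at h3
    push_cast at h3
    linarith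
  have hsumx : ∀ g : V → ℤ, ∑ t ∈ Finset.range (M + 2), g (x t) = ∑ v, g v := by
    intro g
    rw [← hM, Finset.sum_range, ← e.sum_comp]
    refine Finset.sum_congr rfl fun i _ => ?_
    simp [x]
  have key := le_two_mul_sub_of_slack (D := 2 * h + 1) (A := 2 ^ h) (M := M)
    (F := fun t => f (x t)) (l := fun t => L (x t))
    (a := fun t => if L (x t) = h then 1 else 0) (b := fun t => if L (x t) = 0 then 1 else 0)
    ?_ ?_ ?_ ?_ ?_ ?_
  · have hw := (hsumx fun v => L v).trans (hsum fun i => i)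
    rw [sum_two_pow_mul_self] at hw
    rw [hw] at key
    have hspan : f (x (M + 1)) - f (x 0) ≤ span f :=
      Finset.le_sup (f := fun xy : V × V => f xy.1 - f xy.2) (Finset.mem_univ (x (M + 1), x 0))
    have hspan' : (f (x (M + 1)) : ℤ) - f (x 0) ≤ span f := by omega
    have hM' : (M : ℤ) = 2 * 2 ^ h - 3 := by
      rw [hM, pow_succ] at hcard
      push_cast at hcard
      linarith
    rw [hM', pow_succ] at key
    linarith
  · intro t ht
    have h1 := hxlt t (t + 1) (by omega) (by omega)
    have h2 := hdist (x t) (x (t + 1))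
    omega
  · intro t ht
    have h1 := hxlt t (t + 1) (by omega) (by omega)
    have h2 := hdist (x t) (x (t + 1))
    have h3 := hxlt (t + 1) (t + 2) (by omega) (by omega)
    have h4 := hdist (x (t + 1)) (x (t + 2))
    have h5 := hxlt t (t + 2) (by omega) (by omega)
    have h6 := hbranch (x t) (x (t + 1))
    have h7 := hbranch (x (t + 1)) (x (t + 2))
    have h8 := hbranch (x t) (x (t + 2))
    split_ifs <;> omega
  · intro t
    split_ifs <;> omega
  · intro t
    split_ifs <;> omega
  · rw [hsumx fun v => if L v = h then 1 else 0, hsum fun i => if i = h then 1 else 0]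
    simp
  · rw [hsumx fun v => if L v = 0 then 1 else 0, hsum fun i => if i = 0 then 1 else 0]
    simp

/-- The correction making two consecutive leaves differ by `2` when the first is in even
position. -/
def leafSlack (h q : ℕ) : ℕ := if 2 ^ h ≤ q ∧ q % 2 = 0 then 1 else 0

/-- An optimal label for the vertex in position `q` of the order defining `heapLevel`. -/
def heapLabel (h q : ℕ) : ℕ :=
  ∑ i ∈ Finset.Ico 2 q, (2 * h + 1 + leafSlack h i - heapLevel h i - heapLevel h (i + 1))

theorem heapLabel_succ {h q : ℕ} (h2 : 2 ≤ q) (hq : q < 2 ^ (h + 1)) :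
    heapLabel h (q + 1) + heapLevel h q + heapLevel h (q + 1) =
      heapLabel h q + (2 * h + 1) + leafSlack h q := by
  have h1 := heapLevel_le hq.le
  have h3 := heapLevel_le (Nat.succ_le_of_lt hq)
  rw [heapLabel, Finset.sum_Ico_succ_top h2, ← heapLabel]
  simp only [Nat.succ_eq_add_one] at h3
  omega

theorem heapLabel_mono (h : ℕ) : Monotone (heapLabel h) := fun _ _ hab =>
  Finset.sum_le_sum_of_subset (Finset.Ico_subset_Ico le_rfl hab)

theorem one_add_two_mul_heapLevel_le {h q : ℕ} (hh : 1 ≤ h) (h2 : 2 ≤ q)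
    (hq : q + 1 < 2 ^ (h + 1)) :
    1 + 2 * heapLevel h (q + 1) ≤ 2 * h + leafSlack h q + leafSlack h (q + 1) := by
  rcases (heapLevel_le hq.le).lt_or_eq with h1 | h1
  · omega
  · have h3 : 2 ^ h ≤ q + 1 := by
      have := Nat.pow_log_le_self 2 (x := q + 1) (by omega)
      rwa [← heapLevel_of_lt hq, h1] at this
    obtain ⟨k, rfl⟩ : ∃ k, h = k + 1 := ⟨h - 1, by omega⟩
    rw [pow_succ] at h3
    unfold leafSlack
    rw [pow_succ]
    split_ifs <;> omega

theorem heapLabel_add_two_le {h q : ℕ} (hh : 1 ≤ h) (h2 : 2 ≤ q) (d : ℕ)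
    (hq : q + d + 2 ≤ 2 ^ (h + 1)) :
    heapLabel h q + (2 * h + 1) + (d + 2) ≤
      heapLabel h (q + d + 2) + heapLevel h q + heapLevel h (q + d + 2) := by
  induction d with
  | zero =>
    have h1 := heapLabel_succ h2 (show q < 2 ^ (h + 1) by omega)
    have h3 := heapLabel_succ (show 2 ≤ q + 1 by omega) (show q + 1 < 2 ^ (h + 1) by omega)
    have h4 := one_add_two_mul_heapLevel_le hh h2 (show q + 1 < 2 ^ (h + 1) by omega)
    simp only [add_zero, add_assoc, Nat.reduceAdd] at *
    omega
  | succ d ih =>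
    have h1 := ih (by omega)
    have h3 := heapLabel_succ (show 2 ≤ q + d + 2 by omega)
      (show q + d + 2 < 2 ^ (h + 1) by omega)
    have h4 := heapLevel_le (show q + d + 2 ≤ 2 ^ (h + 1) by omega)
    simp only [show q + (d + 1) + 2 = q + d + 2 + 1 by omega]
    omega

theorem heapLabel_last {h : ℕ} (hh : 1 ≤ h) :
    (2 * heapLabel h (2 ^ (h + 1)) : ℤ) = 13 * 2 ^ h - 8 * h - 10 := by
  have key : ∀ d, d + 2 ≤ 2 ^ (h + 1) →
      (heapLabel h (d + 2) : ℤ) + 2 * ∑ i ∈ Finset.Ico 2 (d + 2), (heapLevel h i : ℤ)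
        + heapLevel h (d + 2) = d * (2 * h + 1) + 1 + ((d + 2 - 2 ^ h + 1) / 2 : ℕ) := by
    have h2 : 2 ≤ 2 ^ h := Nat.le_self_pow (by omega) 2
    have he : 2 ^ h % 2 = 0 := Nat.mod_eq_zero_of_dvd (dvd_pow_self 2 (by omega))
    intro d
    induction d with
    | zero =>
      intro _
      have h1 : heapLevel h 2 = 1 := heapLevel_two_pow_add (i := 1) (e := 0) hh (by norm_num)
      have h3 : (0 + 2 - 2 ^ h + 1) / 2 = 0 := by omega
      rw [h3]
      simp [heapLabel, h1]
    | succ d ih =>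
      intro hd
      have h1 := ih (by omega)
      have h3 := heapLabel_succ (show 2 ≤ d + 2 by omega) (show d + 2 < 2 ^ (h + 1) by omega)
      have h4 : (d + 1 + 2 - 2 ^ h + 1) / 2 = (d + 2 - 2 ^ h + 1) / 2 + leafSlack h (d + 2) := by
        unfold leafSlack
        split_ifs <;> omega
      rw [show d + 1 + 2 = d + 2 + 1 by omega] at *
      rw [h4, Finset.sum_Ico_succ_top (by omega)]
      zify at h3
      push_cast at h1 ⊢
      linarith
  have h1 : 2 ≤ 2 ^ (h + 1) := Nat.le_self_pow (by omega) 2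
  have h3 := key (2 ^ (h + 1) - 2) (by omega)
  have hw := sum_heapLevel h fun i => i
  rw [sum_two_pow_mul_self, ← Finset.Ico_insert_right h1, Finset.sum_insert (by simp),
    heapLevel_last, Nat.cast_zero, zero_add] at hw
  rw [Nat.sub_add_cancel h1, hw, heapLevel_last, Nat.cast_sub h1] at h3
  generalize heapLabel h (2 ^ (h + 1)) = F at h3 ⊢
  obtain ⟨k, rfl⟩ : ∃ k, h = k + 1 := ⟨h - 1, by omega⟩
  have h4 : (2 ^ (k + 1 + 1) - 2 ^ (k + 1) + 1) / 2 = 2 ^ k := by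
    rw [pow_succ 2 (k + 1), pow_succ]
    omega
  rw [h4] at h3
  push_cast at h3 ⊢
  rw [pow_succ _ (k + 1), pow_succ] at h3
  rw [pow_succ]
  linarith

theorem BinaryCoords.exists_isRadioLabelling {V : Type*} [Fintype V] [DecidableEq V]
    {G : SimpleGraph V} {h : ℕ} {p : ℕ → ℕ → V} (C : BinaryCoords G h p) (hh : 1 ≤ h) :
    ∃ f : V → ℕ, IsRadioLabelling G f ∧ span f ≤ heapLabel h (2 ^ (h + 1)) := by
  choose! code hcode hpc using fun x => C.bijOn.surjOn (Set.mem_univ x)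
  dsimp only at hpc
  have hlt : ∀ x y, code x < code y → heapLabel h (code x) + (2 * h + 1) ≤
      heapLabel h (code y) + G.dist x y := by
    intro x y hxy
    obtain ⟨k, hk, hk', hmod, hd⟩ := C.exists_le_dist (code x) (code y)
      (heapLevel_le (hcode x).2) (heapLevel_le (hcode y).2)
    rw [hpc, hpc] at hd
    have hk2 : 2 ^ k ≤ code y - code x :=
      Nat.le_of_dvd (by omega) ((Nat.modEq_iff_dvd' hxy.le).1 hmod)
    obtain ⟨d, hd' | hd'⟩ : ∃ d, code y = code x + 1 ∨ code y = code x + d + 2 :=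
      ⟨code y - code x - 2, by omega⟩
    · have hk0 : k = 0 := by
        by_contra h0
        have := Nat.one_lt_two_pow h0
        omega
      have := heapLabel_succ (hcode x).1 (show code x < 2 ^ (h + 1) by have := (hcode y).2; omega)
      rw [← hd'] at this
      omega
    · have := heapLabel_add_two_le hh (hcode x).1 d (hd' ▸ (hcode y).2)
      rw [← hd'] at this
      have hk3 : 2 * k ≤ 2 ^ k ∨ k = 0 := by
        rcases k with _ | k
        · exact .inr rfl
        · left
          have := Nat.lt_two_pow_self (n := k)
          rw [pow_succ]
          omega
      omega
  refine ⟨fun x => heapLabel h (code x), fun x y hxy => ?_, Finset.sup_le fun xy _ => ?_⟩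
  · have hne : code x ≠ code y := fun hc => hxy <| by
      rw [← hpc x, ← hpc y, hc]
    rw [C.gdiam_eq]
    rcases hne.lt_or_gt with h1 | h1
    · have := hlt x y h1
      rw [abs_sub_comm]
      refine le_trans ?_ (le_abs_self _)
      push_cast
      omega
    · have := hlt y x h1
      rw [SimpleGraph.dist_comm] at this
      refine le_trans ?_ (le_abs_self _)
      push_cast
      omega
  · exact (Nat.sub_le _ _).trans (heapLabel_mono h (hcode xy.1).2)

theorem IsLevelwiseRegular.exists_binaryCoords {V : Type*} [Fintype V] [DecidableEq V]
    {G : SimpleGraph V} {h : ℕ}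
    (hG : IsLevelwiseRegular G 1 h (fun i => if i = 0 then 2 else 3)) :
    ∃ p, BinaryCoords G h p := by
  obtain ⟨hT, S, d, hS, -, hd, hle, -, hdeg⟩ := hG
  obtain ⟨r, rfl⟩ := Finset.card_eq_one.1 hS
  have hdr : ∀ x, d x = G.dist r x := fun x => by
    obtain ⟨c, hc, hcd⟩ := (hd x).1
    rw [Finset.mem_singleton.1 hc, SimpleGraph.dist_comm] at hcd
    exact hcd.symm
  simp only [hdr] at hle hdeg
  exact RadioPaper.exists_binaryCoords hT hle hdeg

/-- **Corollary (complete binary trees).** For `h ≥ 2`, the radio number of the complete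
binary tree of height `h` is `13·2^{h-1} - 4h - 5`. -/
theorem stmt7 {V : Type*} [Fintype V] [DecidableEq V] (G : SimpleGraph V)
    (h : ℕ) (hh : 2 ≤ h)
    (hG : IsLevelwiseRegular G 1 h (fun i => if i = 0 then 2 else 3)) :
    (radioNumber G : ℤ) = 13 * 2 ^ (h - 1) - 4 * h - 5 := by
  obtain ⟨p, C⟩ := hG.exists_binaryCoords
  obtain ⟨f, hf, hspan⟩ := C.exists_isRadioLabelling (by omega)
  have hlast := heapLabel_last (h := h) (by omega)
  have hle : radioNumber G ≤ span f := Nat.sInf_le ⟨f, hf, rfl⟩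
  obtain ⟨g, hg, hgs⟩ := Nat.sInf_mem (s := {s | ∃ f : V → ℕ, IsRadioLabelling G f ∧ span f = s})
    ⟨_, f, hf, rfl⟩
  have hge := C.le_two_mul_span hh hg
  rw [hgs, ← radioNumber] at hge
  obtain ⟨k, rfl⟩ : ∃ k, h = k + 1 := ⟨h - 1, by omega⟩
  rw [pow_succ] at hge
  rw [pow_succ (2 : ℤ) k] at hlast
  rw [Nat.add_sub_cancel]
  push_cast at *
  omega

end RadioPaper
end

section
/- Let T be a two-branch tree with order p and diameter d ≥ 2, let f be a radio labelling of T, and let u_0, u_1, ..., u_{p-1} be the induced linear order of V(T). Let i be an integer with 1 ≤ i ≤ p-3 such that (a) u_i ∉ W(T), u_{i+2} ∉ W(T), and u_{i+1} ∈ S(T); and (b) for t = i, i+1, the vertices u_t and u_{t+1} are in different branches when |W(T)| = 1 and in opposite branches when |W(T)| = 2. Then J_f(u_i, u_{i+1}, u_{i+2}) ≥ |W(T)|. -/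
open SimpleGraph Finset

open scoped Classical

namespace RadioPaper

variable {V : Type*} [Fintype V] [DecidableEq V]

section TreeMetric

variable {U : Type*} {G : SimpleGraph U}

theorem mem_support_of_dist_add_dist (hT : G.IsTree) {a w c : U}
    (h : G.dist a w + G.dist w c = G.dist a c) (p : G.Walk a c) : w ∈ p.support := by
  obtain ⟨q, -, hq⟩ := hT.connected.exists_path_of_dist a w
  obtain ⟨r, -, hr⟩ := hT.connected.exists_path_of_dist w c
  have hpath : (q.append r).IsPath :=
    Walk.isPath_of_length_eq_dist _ (by rw [Walk.length_append, hq, hr, h])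
  have heq := (hT.existsUnique_path a c).unique hpath p.bypass_isPath
  apply p.support_bypass_subset_support
  rw [← heq]
  simp

theorem dist_add_dist_of_mem_support (hT : G.IsTree) {a w c : U} {p : G.Walk a c}
    (hp : p.IsPath) (hw : w ∈ p.support) : G.dist a w + G.dist w c = G.dist a c := by
  obtain ⟨q, hq, hlen⟩ := hT.connected.exists_path_of_dist a c
  obtain rfl := (hT.existsUnique_path a c).unique hp hq
  refine le_antisymm ?_ hT.connected.dist_triangle
  rw [← hlen, ← congrArg Walk.length (p.take_spec hw), Walk.length_append]
  exact Nat.add_le_add (dist_le _) (dist_le _)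

/-- In a tree, if the edge `xx'` leads away from `a` and towards `c`, then `x` lies between
`a` and `c`. -/
theorem dist_add_dist_of_adj (hT : G.IsTree) {a c x x' : U} (hadj : G.Adj x x')
    (ha : G.dist a x' = G.dist a x + 1) (hc : G.dist x c = G.dist x' c + 1) :
    G.dist a x + G.dist x c = G.dist a c := by
  obtain ⟨p, hp, -⟩ := hT.connected.exists_path_of_dist a c
  obtain ⟨q, hq, -⟩ := hT.connected.exists_path_of_dist c x'
  have hxx' : G.dist x x' = 1 := dist_eq_one_iff_adj.mpr hadj
  have hmem : x ∈ (p.append q).support :=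
    mem_support_of_dist_add_dist hT (by rw [hxx', ha]) _
  rcases (Walk.mem_support_append_iff _ _).mp hmem with h | h
  · exact dist_add_dist_of_mem_support hT hp h
  · have := dist_add_dist_of_mem_support hT hq h
    rw [hxx', G.dist_comm (u := c) (v := x), G.dist_comm (u := c) (v := x')] at this
    omega

theorem exists_adj_dist_eq_add_one_s11 (hG : G.Connected) {w c : U} (hne : w ≠ c) :
    ∃ w', G.Adj w w' ∧ G.dist w c = G.dist w' c + 1 := by
  obtain ⟨p, -, hp⟩ := hG.exists_path_of_dist w c
  cases p with
  | nil => exact absurd rfl hne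
  | @cons _ w' _ h q =>
    refine ⟨w', h, le_antisymm ?_ ?_⟩
    · have := hG.dist_triangle (u := w) (v := w') (w := c)
      rw [dist_eq_one_iff_adj.mpr h] at this
      omega
    · rw [← hp, Walk.length_cons]
      exact Nat.add_le_add_right (dist_le q) 1

theorem dist_add_two_le_of_not_mem_support (hT : G.IsTree) {a w c : U} (p : G.Walk a c)
    (hw : w ∉ p.support) : G.dist a c + 2 ≤ G.dist a w + G.dist w c := by
  have hne : w ≠ c := fun h => hw (h ▸ p.end_mem_support)
  obtain ⟨w', hadj, hc⟩ := exists_adj_dist_eq_add_one_s11 hT.connected hne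
  have htri := hT.connected.dist_triangle (u := a) (v := w') (w := c)
  rcases hT.dist_eq_dist_add_one_of_adj a hadj with h | h
  · omega
  · exact absurd (mem_support_of_dist_add_dist hT (dist_add_dist_of_adj hT hadj h hc) p) hw

end TreeMetric

theorem adj_of_mem_wcenters {G : SimpleGraph V} (hT : G.IsTree) {x y : V}
    (hx : x ∈ wcenters G) (hy : y ∈ wcenters G) (hne : x ≠ y) : G.Adj x y := by
  by_contra hadj
  have hlt := hT.connected.one_lt_dist_of_ne_of_not_adj hne hadj
  obtain ⟨x', hxx', hx'⟩ := exists_adj_dist_eq_add_one_s11 hT.connected hne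
  have hne' : y ≠ x' := by
    rintro rfl
    exact hadj hxx'
  obtain ⟨y', hyy', hy'⟩ := exists_adj_dist_eq_add_one_s11 hT.connected hne'
  have hcomm : ∀ s t, G.dist s t = G.dist t s := fun s t => G.dist_comm
  have htri : ∀ r s t, G.dist r t ≤ G.dist r s + G.dist s t :=
    fun r s t => hT.connected.dist_triangle
  have h1 : G.dist x' x = 1 := dist_eq_one_iff_adj.mpr hxx'.symm
  have h2 : G.dist y y' = 1 := dist_eq_one_iff_adj.mpr hyy'
  have hsum : weight G x' + weight G y' < weight G x + weight G y := by
    unfold weight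
    rw [← Finset.sum_add_distrib, ← Finset.sum_add_distrib]
    refine Finset.sum_lt_sum (fun t _ => ?_) ⟨x', Finset.mem_univ _, ?_⟩
    · have := htri t y y'
      rcases hT.dist_eq_dist_add_one_of_adj t hxx' with h | h
      · omega
      · have hb := dist_add_dist_of_adj hT hxx' h hx'
        have := htri t x y'
        have := htri x x' y'
        have := hcomm x x'
        have := hcomm x' y'
        have := hcomm x' y
        omega
    · have := G.dist_self (v := x')
      have := hcomm x' y
      have := hcomm x' y'
      omega
  have := (Finset.mem_filter.mp hx).2 x'
  have := (Finset.mem_filter.mp hy).2 y'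
  omega

theorem card_wcenters_eq_one_or_two {G : SimpleGraph V} (hT : G.IsTree) :
    (wcenters G).card = 1 ∨ (wcenters G).card = 2 := by
  have := hT.connected.nonempty
  obtain ⟨v, -, hv⟩ := Finset.exists_min_image Finset.univ (weight G) Finset.univ_nonempty
  have hpos : 0 < (wcenters G).card :=
    Finset.card_pos.mpr ⟨v, Finset.mem_filter.mpr ⟨Finset.mem_univ _, fun u => hv u (by simp)⟩⟩
  by_contra hcard
  refine hT.isAcyclic.cliqueFree (n := (wcenters G).card) (by omega) (wcenters G) ⟨?_, rfl⟩
  exact fun x hx y hy hne => adj_of_mem_wcenters hT hx hy hne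

theorem level_le_dist {G : SimpleGraph V} {w : V} (hw : w ∈ wcenters G) (v : V) :
    level G v ≤ G.dist v w :=
  Nat.sInf_le ⟨w, hw, rfl⟩

theorem BranchStep.mem_support {G : SimpleGraph V} (hT : G.IsTree) {a b : V}
    (h : BranchStep G a b) (p : G.Path a b) {w : V} (hw : w ∈ wcenters G) :
    w ∈ p.1.support := by
  have hlen : (p.1.support.filter fun x => decide (x ∈ wcenters G)).length
      = (wcenters G).card := by
    rcases card_wcenters_eq_one_or_two hT with h1 | h2
    · rw [h1]; exact h.1 h1 p
    · rw [h2]; exact h.2 h2 p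
  have hnodup := p.2.support_nodup.filter fun x => decide (x ∈ wcenters G)
  have hsub : (p.1.support.filter fun x => decide (x ∈ wcenters G)).toFinset
      ⊆ wcenters G := by
    intro x hx
    simpa using (List.mem_filter.mp (List.mem_toFinset.mp hx)).2
  have heq := Finset.eq_of_subset_of_card_le hsub
    (by rw [List.toFinset_card_of_nodup hnodup, hlen])
  rw [← heq, List.mem_toFinset] at hw
  exact (List.mem_filter.mp hw).1

theorem BranchStep.dist_add_dist {G : SimpleGraph V} (hT : G.IsTree) {a b : V}
    (h : BranchStep G a b) {w : V} (hw : w ∈ wcenters G) :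
    G.dist a w + G.dist w b = G.dist a b := by
  obtain ⟨p, hp, -⟩ := hT.connected.exists_path_of_dist a b
  exact dist_add_dist_of_mem_support hT hp (h.mem_support hT ⟨p, hp⟩ hw)

theorem SameBranch.exists_walk {G : SimpleGraph V} {a c : V} (h : SameBranch G a c) :
    ∃ p : G.Walk a c, ∀ w ∈ wcenters G, w ∉ p.support := by
  obtain ⟨ha, hc, ⟨q⟩⟩ := h
  let φ := (Embedding.induce (G := G) {x : V | x ∉ wcenters G}).toHom
  refine ⟨q.map φ, fun w hw hmem => ?_⟩
  obtain ⟨y, -, rfl⟩ := List.mem_map.mp (q.support_map φ ▸ hmem)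
  exact y.2 hw

theorem BranchStep.not_sameBranch {G : SimpleGraph V} (hT : G.IsTree) {a b : V}
    (h : BranchStep G a b) : ¬SameBranch G a b := by
  intro hs
  obtain ⟨p, hp⟩ := hs.exists_walk
  obtain ⟨w, hw⟩ : (wcenters G).Nonempty := by
    rw [← Finset.card_pos]
    have := card_wcenters_eq_one_or_two hT
    omega
  exact hp w hw (mem_support_of_dist_add_dist hT (h.dist_add_dist hT hw) p)

theorem TwoBranch.sameBranch {G : SimpleGraph V} (h2 : TwoBranch G) {a b c : V}
    (ha : a ∉ wcenters G) (hb : b ∉ wcenters G) (hc : c ∉ wcenters G)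
    (hab : ¬SameBranch G a b) (hcb : ¬SameBranch G c b) : SameBranch G a c := by
  let H := SimpleGraph.induce {x : V | x ∉ wcenters G} G
  obtain ⟨_, _, huniq⟩ := (Nat.card_eq_two_iff' (H.connectedComponentMk ⟨b, hb⟩)).mp h2
  have hac := (huniq (H.connectedComponentMk ⟨a, ha⟩)
    fun h => hab ⟨ha, hb, ConnectedComponent.exact h⟩).trans
    (huniq (H.connectedComponentMk ⟨c, hc⟩)
      fun h => hcb ⟨hc, hb, ConnectedComponent.exact h⟩).symm
  exact ⟨ha, hc, ConnectedComponent.exact hac⟩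

theorem BranchStep.symm {G : SimpleGraph V} {a b : V} (h : BranchStep G a b) :
    BranchStep G b a := by
  refine ⟨fun h1 p => ?_, fun h2 p => ?_⟩
  · have := h.1 h1 p.reverse
    simpa [Path.reverse, Walk.support_reverse, List.filter_reverse] using this
  · have := h.2 h2 p.reverse
    simpa [Path.reverse, Walk.support_reverse, List.filter_reverse] using this

theorem level_eq_zero_of_mem_wcenters {G : SimpleGraph V} {v : V} (hv : v ∈ wcenters G) :
    level G v = 0 :=
  Nat.le_zero.mp ((level_le_dist hv v).trans_eq G.dist_self)

/-- The excess of `d(a,b) + d(b,c)` over `d(a,c)` when `a, c` lie in one branch and `b` in the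
other one. -/
theorem two_mul_level_add_two_mul_card_le {G : SimpleGraph V} (hT : G.IsTree) {a b c : V}
    (hab : BranchStep G a b) (hbc : BranchStep G b c) (hac : SameBranch G a c) :
    2 * level G b + 2 * (wcenters G).card + G.dist a c ≤ G.dist a b + G.dist b c := by
  obtain ⟨p, hp⟩ := hac.exists_walk
  have excess : ∀ w ∈ wcenters G,
      G.dist a c + 2 + 2 * G.dist b w ≤ G.dist a b + G.dist b c := fun w hw => by
    have := dist_add_two_le_of_not_mem_support hT p (hp w hw)
    have := hab.dist_add_dist hT hw
    have := hbc.dist_add_dist hT hw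
    have := G.dist_comm (u := w) (v := b)
    omega
  rcases card_wcenters_eq_one_or_two hT with h1 | h2
  · obtain ⟨w, hw⟩ := Finset.card_eq_one.mp h1
    have hw : w ∈ wcenters G := by simp [hw]
    have := excess w hw
    have := level_le_dist hw b
    omega
  · obtain ⟨w, w', hne, hW⟩ := Finset.card_eq_two.mp h2
    have hw : w ∈ wcenters G := by simp [hW]
    have hw' : w' ∈ wcenters G := by simp [hW]
    have := excess w hw
    have := excess w' hw'
    have := level_le_dist hw b
    have := level_le_dist hw' b
    have := hT.dist_ne_of_adj b (adj_of_mem_wcenters hT hw hw' hne)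
    omega

/-- **Lemma 5.** -/
theorem stmt11 {V : Type*} [Fintype V] [DecidableEq V] (G : SimpleGraph V)
    (hT : G.IsTree) (hd : 2 ≤ gdiam G) (h2 : TwoBranch G)
    (f : V → ℕ) (hf : IsRadioLabelling G f)
    (u : ℕ → V) (hord : IsInducedOrder G f u)
    (i : ℕ) (hi1 : 1 ≤ i) (hi2 : i ≤ Fintype.card V - 3)
    (hW1 : u i ∉ wcenters G) (hW2 : u (i+2) ∉ wcenters G)
    (hS : u (i+1) ∈ remote G)
    (hbr : ∀ t : ℕ, t = i ∨ t = i + 1 → BranchStep G (u t) (u (t+1))) :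
    ((wcenters G).card : ℤ) ≤ Jseg G f u i (i+2) := by
  have hab := hbr i (Or.inl rfl)
  have hbc := hbr (i + 1) (Or.inr rfl)
  have hcard := card_wcenters_eq_one_or_two hT
  have hlevel : gdiam G + 1 ≤ 2 * level G (u (i + 1)) + (wcenters G).card := by
    unfold remote at hS
    split_ifs at hS with h1 <;> have := (Finset.mem_filter.mp hS).2 <;> omega
  have hb : u (i + 1) ∉ wcenters G := fun h => by
    have := level_eq_zero_of_mem_wcenters h
    omega
  have hac : SameBranch G (u i) (u (i + 2)) :=
    h2.sameBranch hW1 hb hW2 (hab.not_sameBranch hT) (hbc.symm.not_sameBranch hT)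
  have hexcess : 2 * level G (u (i + 1)) + 2 * (wcenters G).card + G.dist (u i) (u (i + 2)) ≤
      G.dist (u i) (u (i + 1)) + G.dist (u (i + 1)) (u (i + 2)) :=
    two_mul_level_add_two_mul_card_le hT hab hbc hac
  have hlt : f (u i) < f (u (i + 2)) := hord.2 i (i + 2) (by omega) (by omega)
  have hradio := hf (u (i + 2)) (u i) fun h => by
    rw [h] at hlt
    exact lt_irrefl _ hlt
  rw [abs_of_pos (by omega), G.dist_comm] at hradio
  have hJ : Jseg G f u i (i + 2) = Jstep G f u i + Jstep G f u (i + 1) := by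
    rw [Jseg, Finset.sum_Ico_succ_top (by omega), Finset.sum_Ico_succ_top (by omega)]
    simp
  rw [hJ, Jstep, Jstep, show i + 1 + 1 = i + 2 from rfl]
  omega

end RadioPaper
end
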